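/- arXiv:1901.05833 — 6 statements merged into one kernel-verified Lean document; each statement's English description precedes it below -/
import Mathlib

section
/- Let R be a commutative ring and let α, β, x, y be Hamilton quaternions over R with Nr(α) = 1 and Nr(β) = 1. Then a₁(α·x·conj β, α·y·conj β) = α·a₁(x,y)·conj α and a₂(α·x·conj β, α·y·conj β) = β·a₂(x,y)·conj β. -/
open Quaternion

theorem conj_im_aux {R : Type*} [CommRing R] (a z : ℍ[R]) :
    (a * z * star a).im = a * z.im * star a := by
  ext <;> simp <;> ring

theorem star_mul_one_aux {R : Type*} [CommRing R] (a : ℍ[R])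
    (h : Quaternion.normSq a = 1) : star a * a = 1 := by
  rw [Quaternion.star_mul_self, h]; simp

/-- Equivariance of the associated points: for quaternions `α, β, x, y`
over a commutative ring with `Nr α = Nr β = 1`, one has
`a₁(α x conj β, α y conj β) = α a₁(x,y) conj α` and
`a₂(α x conj β, α y conj β) = β a₂(x,y) conj β`, where `a₁(x,y) = Im(x conj y)` and
`a₂(x,y) = Im(conj y * x)`. -/
theorem stmt_1 (R : Type*) [CommRing R] (α β x y : ℍ[R])
    (hα : Quaternion.normSq α = 1) (hβ : Quaternion.normSq β = 1) :
    ((α * x * star β) * star (α * y * star β)).im = α * (x * star y).im * star α ∧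
      (star (α * y * star β) * (α * x * star β)).im = β * (star y * x).im * star β := by
  have h1 := star_mul_one_aux α hα
  have h2 := star_mul_one_aux β hβ
  constructor
  · rw [← conj_im_aux]
    congr 1
    calc α * x * star β * star (α * y * star β)
        = α * x * (star β * β) * star y * star α := by
          simp only [star_mul, star_star, mul_assoc]
      _ = _ := by rw [h2]; simp only [mul_one, mul_assoc]
  · rw [← conj_im_aux]
    congr 1
    calc star (α * y * star β) * (α * x * star β)
        = β * star y * (star α * α) * x * star β := by
          simp only [star_mul, star_star, mul_assoc]
      _ = _ := by rw [h1]; simp only [mul_one, mul_assoc]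
end

section
/- Let w₁, w₂ ∈ ℤ⁴ be nonzero with re(w₁) = re(w₂) = 0 and Nr(w₁) = Nr(w₂), and assume the pair (w₁,w₂) is pair-primitive. Set L = {x ∈ ℍ(ℚ) : w₁·x = x·w₂}. Then L is a 2-dimensional ℚ-subspace of ℍ(ℚ), and for every ℤ-basis (v₁,v₂) of L ∩ ℤ⁴ the following holds: if w₁ ≡ w₂ mod 2 coordinatewise then (a₁(v₁,v₂), a₂(v₁,v₂)) equals (w₁,w₂) or (−w₁,−w₂); otherwise (a₁(v₁,v₂), a₂(v₁,v₂)) equals (2w₁,2w₂) or (−2w₁,−2w₂). -/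
open Quaternion

/-- A quaternion over `ℚ` has integer coordinates, i.e. lies in `ℤ⁴`. -/
def IsIntegerQuat (x : ℍ[ℚ]) : Prop :=
  ∃ a b c d : ℤ, x.re = a ∧ x.imI = b ∧ x.imJ = c ∧ x.imK = d

/-- `(v₁, v₂)` is a `ℤ`-basis of the lattice `L ∩ ℤ⁴`. -/
def IsZBasisQuat (L : Submodule ℚ ℍ[ℚ]) (v₁ v₂ : ℍ[ℚ]) : Prop :=
  v₁ ∈ L ∧ v₂ ∈ L ∧ IsIntegerQuat v₁ ∧ IsIntegerQuat v₂ ∧ LinearIndependent ℚ ![v₁, v₂] ∧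
    ∀ x ∈ L, IsIntegerQuat x → ∃ m n : ℤ, x = (m : ℚ) • v₁ + (n : ℚ) • v₂

/-- A pair of integer vectors `(w₁, w₂)` is *pair-primitive*: no odd prime divides all
coordinates of both `w₁` and `w₂`, and it is not the case that `4` divides all coordinates
of `w₁ + w₂` and all coordinates of `w₁ - w₂`. -/
def PairPrimitive (w₁ w₂ : ℍ[ℚ]) : Prop :=
  (∀ p : ℕ, p.Prime → p ≠ 2 →
      ¬(IsIntegerQuat ((p : ℚ)⁻¹ • w₁) ∧ IsIntegerQuat ((p : ℚ)⁻¹ • w₂))) ∧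
    ¬(IsIntegerQuat ((4 : ℚ)⁻¹ • (w₁ + w₂)) ∧ IsIntegerQuat ((4 : ℚ)⁻¹ • (w₁ - w₂)))

/-- The `ℚ`-subspace `{x ∈ ℍ(ℚ) : w₁ x = x w₂}`. -/
def commuteSubmodule (w₁ w₂ : ℍ[ℚ]) : Submodule ℚ ℍ[ℚ] where
  carrier := {x | w₁ * x = x * w₂}
  add_mem' := by
    intro a b ha hb
    simp only [Set.mem_setOf_eq] at *
    rw [mul_add, add_mul, ha, hb]
  zero_mem' := by simp
  smul_mem' := by
    intro c x hx
    simp only [Set.mem_setOf_eq] at *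
    rw [mul_smul_comm, smul_mul_assoc, hx]

def qmk (a b c d : ℚ) : ℍ[ℚ] := ⟨a, b, c, d⟩

@[simp] theorem qmk_re (a b c d : ℚ) : (qmk a b c d).re = a := rfl

@[simp] theorem qmk_imI (a b c d : ℚ) : (qmk a b c d).imI = b := rfl

@[simp] theorem qmk_imJ (a b c d : ℚ) : (qmk a b c d).imJ = c := rfl

@[simp] theorem qmk_imK (a b c d : ℚ) : (qmk a b c d).imK = d := rfl

theorem aux_ratio {ι : Type} (u u' : ι → ℤ) (hu : ∀ p : ℕ, p.Prime → ¬ ∀ i, (p : ℤ) ∣ u i)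
    (hu' : ∀ p : ℕ, p.Prime → ¬ ∀ i, (p : ℤ) ∣ u' i) (κ : ℚ)
    (h : ∀ i, (u i : ℚ) = κ * u' i) : κ = 1 ∨ κ = -1 := by
  have hd : (κ.den : ℚ) ≠ 0 := by exact_mod_cast κ.den_nz
  have h' : ∀ i, (κ.den : ℤ) * u i = κ.num * u' i := by
    intro i
    have h1 := h i
    rw [← Rat.num_div_den κ] at h1
    have : (κ.den : ℚ) * u i = κ.num * u' i := by
      rw [h1]; field_simp
    exact_mod_cast this
  have hc := κ.reduced
  have hnum : κ.num.natAbs = 1 := by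
    by_contra hne
    obtain ⟨p, hp, hpd⟩ := Nat.exists_prime_and_dvd hne
    refine hu p hp fun i => ?_
    have h1 : (p : ℤ) ∣ κ.num := Int.natCast_dvd.2 hpd
    have h2 : (p : ℤ) ∣ κ.den * u i := by rw [h' i]; exact Dvd.dvd.mul_right h1 _
    rcases (Nat.prime_iff_prime_int.1 hp).dvd_or_dvd h2 with h3 | h3
    · have h4 : p ∣ κ.den := by exact_mod_cast h3
      exact absurd (Nat.dvd_gcd hpd h4) (by rw [hc]; exact hp.one_lt.ne' ∘ Nat.dvd_one.1)
    · exact h3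
  have hden : κ.den = 1 := by
    by_contra hne
    obtain ⟨p, hp, hpd⟩ := Nat.exists_prime_and_dvd hne
    refine hu' p hp fun i => ?_
    have h1 : (p : ℤ) ∣ κ.den := by exact_mod_cast hpd
    have h2 : (p : ℤ) ∣ κ.num * u' i := by rw [← h' i]; exact Dvd.dvd.mul_right h1 _
    rcases (Nat.prime_iff_prime_int.1 hp).dvd_or_dvd h2 with h3 | h3
    · have h4 : p ∣ κ.num.natAbs := Int.natCast_dvd.1 h3
      exact absurd (Nat.dvd_gcd h4 hpd) (by rw [hc]; exact hp.one_lt.ne' ∘ Nat.dvd_one.1)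
    · exact h3
  rw [← Rat.num_div_den κ, hden]
  rcases Int.natAbs_eq κ.num with h1 | h1 <;> rw [hnum] at h1 <;> rw [h1] <;> norm_num

theorem aux_minor (p : ℕ) (hp : p.Prime) (x y : Fin 4 → ℤ)
    (h : ∀ i j, (p : ℤ) ∣ x i * y j - x j * y i) :
    ∃ m n : ℤ, ¬((p : ℤ) ∣ m ∧ (p : ℤ) ∣ n) ∧ ∀ i, (p : ℤ) ∣ m * x i + n * y i := by
  by_cases hx : ∀ i, (p : ℤ) ∣ x i
  · refine ⟨1, 0, fun hh => (Nat.prime_iff_prime_int.1 hp).not_dvd_one hh.1, fun i => ?_⟩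
    simpa using hx i
  · push Not at hx
    obtain ⟨i, hi⟩ := hx
    refine ⟨-y i, x i, fun hh => hi hh.2, fun j => ?_⟩
    have := h i j
    convert this using 1
    ring

theorem aux_comm (w z : ℍ[ℚ]) (hw : w ≠ 0) (hre : w.re = 0) (h : w * z = z * w) :
    ∃ r l : ℚ, z = r • (1 : ℍ[ℚ]) + l • w := by
  have h1 := congrArg QuaternionAlgebra.imI h
  have h2 := congrArg QuaternionAlgebra.imJ h
  have h3 := congrArg QuaternionAlgebra.imK h
  simp [hre] at h1 h2 h3
  have e1 : w.imJ * z.imK = w.imK * z.imJ := by linarith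
  have e2 : w.imK * z.imI = w.imI * z.imK := by linarith
  have e3 : w.imI * z.imJ = w.imJ * z.imI := by linarith
  have key : ∃ l, z.imI = l * w.imI ∧ z.imJ = l * w.imJ ∧ z.imK = l * w.imK := by
    by_cases ha : w.imI = 0
    · by_cases hb : w.imJ = 0
      · by_cases hc : w.imK = 0
        · exact absurd (by ext <;> simp [ha, hb, hc, hre]) hw
        · refine ⟨z.imK / w.imK, ?_, ?_, ?_⟩ <;> field_simp <;> linarith
      · refine ⟨z.imJ / w.imJ, ?_, ?_, ?_⟩ <;> field_simp <;> linarith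
    · refine ⟨z.imI / w.imI, ?_, ?_, ?_⟩ <;> field_simp <;> linarith
  obtain ⟨l, q1, q2, q3⟩ := key
  exact ⟨z.re, l, by ext <;> simp [q1, q2, q3, hre]⟩

theorem aux_sq (w : ℍ[ℚ]) (hre : w.re = 0) : w * w = -((normSq w : ℚ) • (1 : ℍ[ℚ])) := by
  ext <;> simp [normSq_def', hre] <;> ring

theorem aux_star (w : ℍ[ℚ]) (hre : w.re = 0) : star w = -w := by
  ext <;> simp [hre]

theorem aux_finrank (w₁ w₂ : ℍ[ℚ]) 
    (h₁ : w₁ ≠ 0) (h₂ : w₂ ≠ 0) (hre₁ : w₁.re = 0) (hre₂ : w₂.re = 0)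
    (hnr : normSq w₁ = normSq w₂) :
    Module.finrank ℚ (commuteSubmodule w₁ w₂) = 2 := by
  have hx : ∃ x : ℍ[ℚ], x ≠ 0 ∧ w₁ * x = x * w₂ := by
    by_contra hcon
    push Not at hcon
    have hy : ∀ y : ℍ[ℚ], w₁ * y + y * w₂ = 0 := by
      intro y
      by_contra hne
      apply hcon _ hne
      rw [mul_add, add_mul, ← mul_assoc, mul_assoc y, aux_sq _ hre₁, aux_sq _ hre₂, hnr, mul_assoc]
      simp only [mul_smul_comm, smul_mul_assoc, mul_one, one_mul, mul_neg, neg_mul, mul_assoc]; exact add_comm _ _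
    have e : w₂ = -w₁ := by
      have := hy 1
      simp at this
      exact (neg_eq_of_add_eq_zero_right this).symm
    subst e
    have hi := hy (qmk 0 1 0 0)
    have hj := hy (qmk 0 0 1 0)
    apply h₁
    have i1 := congrArg QuaternionAlgebra.imJ hi
    have i2 := congrArg QuaternionAlgebra.imK hi
    have i3 := congrArg QuaternionAlgebra.imK hj
    simp at i1 i2 i3
    ext
    · simpa using hre₁
    · simp; linarith
    · simp; linarith
    · simp; linarith
  obtain ⟨x, hx0, hx⟩ := hx
  have hli : LinearIndependent ℚ ![x, x * w₂] := by
    rw [LinearIndependent.pair_iff]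
    intro s t hst
    have h0 : x * (s • (1 : ℍ[ℚ]) + t • w₂) = 0 := by
      rw [← hst, mul_add]; simp only [mul_smul_comm, smul_mul_assoc, mul_one, one_mul, mul_neg, neg_mul]
    have h1 := (mul_eq_zero.1 h0).resolve_left hx0
    have hs : s = 0 := by
      have := congrArg QuaternionAlgebra.re h1
      simpa [hre₂] using this
    subst hs
    simp at h1
    exact ⟨rfl, h1.resolve_right h₂⟩
  have hspan : commuteSubmodule w₁ w₂ = Submodule.span ℚ (Set.range ![x, x * w₂]) := by
    apply le_antisymm
    · intro y hy
      have hy' : w₁ * y = y * w₂ := hy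
      have hc : w₂ * (x⁻¹ * y) = (x⁻¹ * y) * w₂ := by
        have : w₂ * x⁻¹ = x⁻¹ * w₁ := by
          rw [eq_inv_mul_iff_mul_eq₀ hx0, ← mul_assoc, ← hx, mul_assoc, mul_inv_cancel₀ hx0, mul_one]
        rw [← mul_assoc, this, mul_assoc, hy', mul_assoc]
      obtain ⟨r, l, hrl⟩ := aux_comm _ _ h₂ hre₂ hc
      have : y = r • x + l • (x * w₂) := by
        have : y = x * (x⁻¹ * y) := by rw [← mul_assoc, mul_inv_cancel₀ hx0, one_mul]
        rw [this, hrl, mul_add]; simp only [mul_smul_comm, smul_mul_assoc, mul_one, one_mul, mul_neg, neg_mul]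
      rw [this]
      refine add_mem (Submodule.smul_mem _ _ (Submodule.subset_span ⟨0, rfl⟩))
        (Submodule.smul_mem _ _ (Submodule.subset_span ⟨1, rfl⟩))
    · rw [Submodule.span_le]
      rintro _ ⟨i, rfl⟩
      fin_cases i
      · exact hx
      · change w₁ * (x * w₂) = x * w₂ * w₂
        rw [← mul_assoc, hx]
  rw [hspan, finrank_span_eq_card hli]
  simp

theorem aux_lambda (w₁ w₂ v₁ v₂ : ℍ[ℚ]) 
    (h₁ : w₁ ≠ 0) (hre₁ : w₁.re = 0) (hre₂ : w₂.re = 0)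
    (e₁ : w₁ * v₁ = v₁ * w₂) (e₂ : w₁ * v₂ = v₂ * w₂) (hv : v₂ ≠ 0) :
    ∃ l : ℚ, (v₁ * star v₂).im = l • w₁ ∧ (star v₂ * v₁).im = l • w₂ := by
  have e3 : star v₂ * w₁ = w₂ * star v₂ := by
    have := congrArg star e₂
    rw [star_mul, star_mul, aux_star _ hre₁, aux_star _ hre₂] at this
    simpa using this
  have hc : w₁ * (v₁ * star v₂) = (v₁ * star v₂) * w₁ := by
    rw [← mul_assoc, e₁, mul_assoc, mul_assoc, e3]
  obtain ⟨r, l, hrl⟩ := aux_comm _ _ h₁ hre₁ hc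
  have h2 : star v₂ * v₁ = r • (1 : ℍ[ℚ]) + l • w₂ := by
    have hs : star v₂ ≠ 0 := by simpa using hv
    apply mul_right_cancel₀ hs
    rw [mul_assoc, hrl, mul_add, add_mul]
    simp only [mul_smul_comm, smul_mul_assoc, mul_one, one_mul, mul_neg, neg_mul, e3]
  refine ⟨l, ?_, ?_⟩
  · rw [hrl]; ext <;> simp [hre₁]
  · rw [h2]; ext <;> simp [hre₂]

theorem aux_int_p (q : ℚ) (hq : q ≠ 0) (a b c d a' b' c' d' : ℤ) (x : ℍ[ℚ]) (hx : x = qmk a b c d)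
    (ha : (a : ℚ) = q * a') (hb : (b : ℚ) = q * b') (hc : (c : ℚ) = q * c')
    (hd : (d : ℚ) = q * d') :
    IsIntegerQuat (q⁻¹ • x) := by
  subst hx
  refine ⟨a', b', c', d', ?_, ?_, ?_, ?_⟩ <;> simp [ha, hb, hc, hd, hq]

theorem aux_prim (L : Submodule ℚ ℍ[ℚ]) (x y : Fin 4 → ℤ)
    (h : IsZBasisQuat L (qmk (x 0) (x 1) (x 2) (x 3)) (qmk (y 0) (y 1) (y 2) (y 3))) (p : ℕ) (hp : p.Prime) :
    ¬ ∀ i j, (p : ℤ) ∣ x i * y j - x j * y i := by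
  intro hd
  obtain ⟨m, n, hmn, hdv⟩ := aux_minor p hp x y hd
  obtain ⟨h1, h2, -, -, hli, hb⟩ := h
  choose z hz using hdv
  have hp0 : (p : ℚ) ≠ 0 := by exact_mod_cast hp.ne_zero
  have hz' : ∀ i, (m * x i + n * y i : ℚ) = p * z i := fun i => by exact_mod_cast hz i
  have heq : (qmk (z 0) (z 1) (z 2) (z 3)) = ((p : ℚ)⁻¹ * m) • (qmk (x 0) (x 1) (x 2) (x 3))
      + ((p : ℚ)⁻¹ * n) • (qmk (y 0) (y 1) (y 2) (y 3)) := by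
    have hz2 : ∀ i, (z i : ℚ) = (p : ℚ)⁻¹ * m * x i + (p : ℚ)⁻¹ * n * y i := by
      intro i
      field_simp
      linarith [hz' i]
    ext <;> simp [hz2]
  obtain ⟨m', n', hm⟩ := hb (qmk (z 0) (z 1) (z 2) (z 3))
    (by rw [heq]; exact add_mem (L.smul_mem _ h1) (L.smul_mem _ h2)) ⟨_, _, _, _, rfl, rfl, rfl, rfl⟩
  rw [LinearIndependent.pair_iff] at hli
  have := hli ((p : ℚ)⁻¹ * m - m') ((p : ℚ)⁻¹ * n - n') (by
    rw [sub_smul, sub_smul]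
    rw [heq] at hm
    rw [sub_add_sub_comm, hm, sub_self])
  apply hmn
  obtain ⟨q1, q2⟩ := this
  field_simp at q1 q2
  refine ⟨⟨m', ?_⟩, ⟨n', ?_⟩⟩
  · have : (m : ℚ) = p * m' := by linarith
    exact_mod_cast this
  · have : (n : ℚ) = p * n' := by linarith
    exact_mod_cast this

/-- Let `w₁, w₂ ∈ ℤ⁴` be nonzero pure quaternions with `Nr w₁ = Nr w₂` which
are pair-primitive, and put `L = {x : w₁ x = x w₂}`.  Then `L` is a 2-dimensional
`ℚ`-subspace and for any `ℤ`-basis `(v₁, v₂)` of `L ∩ ℤ⁴`: if `w₁ ≡ w₂ mod 2` then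
`(a₁(v₁,v₂), a₂(v₁,v₂)) = ±(w₁, w₂)`, and otherwise `(a₁(v₁,v₂), a₂(v₁,v₂)) = ±(2w₁, 2w₂)`. -/
theorem stmt_9 (w₁ w₂ : ℍ[ℚ]) (hw₁ : IsIntegerQuat w₁) (hw₂ : IsIntegerQuat w₂)
    (h₁ : w₁ ≠ 0) (h₂ : w₂ ≠ 0) (hre₁ : w₁.re = 0) (hre₂ : w₂.re = 0)
    (hnr : Quaternion.normSq w₁ = Quaternion.normSq w₂)
    (hpp : PairPrimitive w₁ w₂) :
    Module.finrank ℚ (commuteSubmodule w₁ w₂) = 2 ∧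
      ∀ v₁ v₂ : ℍ[ℚ], IsZBasisQuat (commuteSubmodule w₁ w₂) v₁ v₂ →
        (IsIntegerQuat ((2 : ℚ)⁻¹ • (w₁ - w₂)) →
          ((v₁ * star v₂).im = w₁ ∧ (star v₂ * v₁).im = w₂) ∨
            ((v₁ * star v₂).im = -w₁ ∧ (star v₂ * v₁).im = -w₂)) ∧
        (¬IsIntegerQuat ((2 : ℚ)⁻¹ • (w₁ - w₂)) →
          ((v₁ * star v₂).im = 2 * w₁ ∧ (star v₂ * v₁).im = 2 * w₂) ∨
            ((v₁ * star v₂).im = -(2 * w₁) ∧ (star v₂ * v₁).im = -(2 * w₂))) := by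
  refine ⟨aux_finrank w₁ w₂ h₁ h₂ hre₁ hre₂ hnr, ?_⟩
  intro v₁ v₂ hv
  have hv0 := hv
  obtain ⟨m1, m2, ⟨s, s1, s2, s3, k0, k1, k2, k3⟩, ⟨t, t1, t2, t3, k0', k1', k2', k3'⟩, hli, -⟩ := hv0
  have hv2 : v₂ ≠ 0 := hli.ne_zero 1
  obtain ⟨l, hl1, hl2⟩ := aux_lambda w₁ w₂ v₁ v₂ h₁ hre₁ hre₂ m1 m2 hv2
  have E1 : v₁ = qmk (![s, s1, s2, s3] 0 : ℤ) (![s, s1, s2, s3] 1 : ℤ)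
      (![s, s1, s2, s3] 2 : ℤ) (![s, s1, s2, s3] 3 : ℤ) := by
    ext <;> simp [k0, k1, k2, k3]
  have E2 : v₂ = qmk (![t, t1, t2, t3] 0 : ℤ) (![t, t1, t2, t3] 1 : ℤ)
      (![t, t1, t2, t3] 2 : ℤ) (![t, t1, t2, t3] 3 : ℤ) := by
    ext <;> simp [k0', k1', k2', k3']
  have hprim : ∀ p : ℕ, p.Prime → ¬ ∀ i, (p : ℤ) ∣
      (![t * s1 - s * t1, t * s2 - s * t2, t * s3 - s * t3,
        s2 * t3 - s3 * t2, s3 * t1 - s1 * t3, s1 * t2 - s2 * t1] : Fin 6 → ℤ) i := by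
    intro p hp hd
    rw [E1, E2] at hv
    refine aux_prim _ _ _ hv p hp ?_
    have d0 := hd 0
    have d1 := hd 1
    have d2 := hd 2
    have d3 := hd 3
    have d4 := hd 4
    have d5 := hd 5
    simp at d0 d1 d2 d3 d4 d5
    have flip : ∀ {a b : ℤ}, (p : ℤ) ∣ a → b = -a → (p : ℤ) ∣ b := by
      rintro a b h rfl; exact (dvd_neg).2 h
    have same : ∀ {a b : ℤ}, (p : ℤ) ∣ a → b = a → (p : ℤ) ∣ b := by
      rintro a b h rfl; exact h
    intro i j
    fin_cases i <;> fin_cases j <;> simp <;>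
      first
      | (refine same (dvd_zero _) ?_; ring1)
      | (refine same d0 ?_; ring1)
      | (refine same d1 ?_; ring1)
      | (refine same d2 ?_; ring1)
      | (refine same d3 ?_; ring1)
      | (refine same d4 ?_; ring1)
      | (refine same d5 ?_; ring1)
      | (refine flip d0 ?_; ring1)
      | (refine flip d1 ?_; ring1)
      | (refine flip d2 ?_; ring1)
      | (refine flip d3 ?_; ring1)
      | (refine flip d4 ?_; ring1)
      | (refine flip d5 ?_; ring1)
  obtain ⟨a0, a1, a2, a3, ea0, ea1, ea2, ea3⟩ := hw₁
  obtain ⟨b0, b1, b2, b3, eb0, eb1, eb2, eb3⟩ := hw₂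
  have ha0 : a0 = 0 := by rw [hre₁] at ea0; exact_mod_cast ea0.symm
  have hb0 : b0 = 0 := by rw [hre₂] at eb0; exact_mod_cast eb0.symm
  have i1 := congrArg QuaternionAlgebra.imI hl1
  have i2 := congrArg QuaternionAlgebra.imJ hl1
  have i3 := congrArg QuaternionAlgebra.imK hl1
  have j1 := congrArg QuaternionAlgebra.imI hl2
  have j2 := congrArg QuaternionAlgebra.imJ hl2
  have j3 := congrArg QuaternionAlgebra.imK hl2
  simp [k0, k1, k2, k3, k0', k1', k2', k3', ea1, ea2, ea3, eb1, eb2, eb3] at i1 i2 i3 j1 j2 j3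
  obtain ⟨hpo, hp4⟩ := hpp
  have W1 : w₁ = qmk a0 a1 a2 a3 := by ext <;> simp [*]
  have W2 : w₂ = qmk b0 b1 b2 b3 := by ext <;> simp [*]
  -- odd primes
  have hodd : ∀ p : ℕ, p.Prime → p ≠ 2 → ¬ ((p : ℤ) ∣ a1 + b1 ∧ (p : ℤ) ∣ a2 + b2 ∧ (p : ℤ) ∣ a3 + b3 ∧
      (p : ℤ) ∣ b1 - a1 ∧ (p : ℤ) ∣ b2 - a2 ∧ (p : ℤ) ∣ b3 - a3) := by
    rintro p hp hp2 ⟨c1, c2, c3, c4, c5, c6⟩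
    have hpc : ∀ z : ℤ, (p : ℤ) ∣ 2 * z → (p : ℤ) ∣ z := by
      intro z hz
      rcases (Nat.prime_iff_prime_int.1 hp).dvd_or_dvd hz with h | h
      · exfalso
        have : p ∣ 2 := by exact_mod_cast h
        exact hp2 ((Nat.prime_dvd_prime_iff_eq hp Nat.prime_two).1 this)
      · exact h
    have hp0 : (p : ℚ) ≠ 0 := by exact_mod_cast hp.ne_zero
    have sA : ∀ a b : ℤ, (p : ℤ) ∣ a + b → (p : ℤ) ∣ b - a → ∃ z, a = p * z := by
      intro a b h h'
      exact hpc _ (by have := dvd_sub h h'; ring_nf at this ⊢; exact this)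
    have sB : ∀ a b : ℤ, (p : ℤ) ∣ a + b → (p : ℤ) ∣ b - a → ∃ z, b = p * z := by
      intro a b h h'
      exact hpc _ (by have := dvd_add h h'; ring_nf at this ⊢; exact this)
    obtain ⟨x1, y1⟩ := sA _ _ c1 c4
    obtain ⟨x2, y2⟩ := sA _ _ c2 c5
    obtain ⟨x3, y3⟩ := sA _ _ c3 c6
    obtain ⟨x4, y4⟩ := sB _ _ c1 c4
    obtain ⟨x5, y5⟩ := sB _ _ c2 c5
    obtain ⟨x6, y6⟩ := sB _ _ c3 c6
    exact hpo p hp hp2 ⟨aux_int_p p hp0 a0 a1 a2 a3 0 x1 x2 x3 w₁ W1 (by simp [ha0])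
        (by exact_mod_cast y1) (by exact_mod_cast y2) (by exact_mod_cast y3),
      aux_int_p p hp0 b0 b1 b2 b3 0 x4 x5 x6 w₂ W2 (by simp [hb0])
        (by exact_mod_cast y4) (by exact_mod_cast y5) (by exact_mod_cast y6)⟩
  constructor
  · rintro ⟨z0, z1, z2, z3, -, f1, f2, f3⟩
    simp [ea1, ea2, ea3, eb1, eb2, eb3] at f1 f2 f3
    have g1 : a1 = b1 + 2 * z1 := by
      have : (a1 : ℚ) = b1 + 2 * z1 := by linarith
      exact_mod_cast this
    have g2 : a2 = b2 + 2 * z2 := by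
      have : (a2 : ℚ) = b2 + 2 * z2 := by linarith
      exact_mod_cast this
    have g3 : a3 = b3 + 2 * z3 := by
      have : (a3 : ℚ) = b3 + 2 * z3 := by linarith
      exact_mod_cast this
    have := aux_ratio _ (![b1 + z1, b2 + z2, b3 + z3, -z1, -z2, -z3] : Fin 6 → ℤ) hprim (by
      intro p hp hd
      have d0 : (p : ℤ) ∣ b1 + z1 := hd 0
      have d1 : (p : ℤ) ∣ b2 + z2 := hd 1
      have d2 : (p : ℤ) ∣ b3 + z3 := hd 2
      have d3 : (p : ℤ) ∣ -z1 := hd 3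
      have d4 : (p : ℤ) ∣ -z2 := hd 4
      have d5 : (p : ℤ) ∣ -z3 := hd 5
      by_cases hp2 : p = 2
      · subst hp2
        obtain ⟨x1, y1⟩ := d0
        obtain ⟨x2, y2⟩ := d1
        obtain ⟨x3, y3⟩ := d2
        obtain ⟨x4, y4⟩ := d3
        obtain ⟨x5, y5⟩ := d4
        obtain ⟨x6, y6⟩ := d5
        push_cast at y1 y2 y3 y4 y5 y6
        have r1 : a1 + b1 = 4 * x1 := by omega
        have r2 : a2 + b2 = 4 * x2 := by omega
        have r3 : a3 + b3 = 4 * x3 := by omega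
        have r4 : a1 - b1 = 4 * -x4 := by omega
        have r5 : a2 - b2 = 4 * -x5 := by omega
        have r6 : a3 - b3 = 4 * -x6 := by omega
        exact hp4 ⟨aux_int_p 4 (by norm_num) (a0 + b0) (a1 + b1) (a2 + b2) (a3 + b3) 0 x1 x2 x3 _
            (by rw [W1, W2]; ext <;> simp) (by simp [ha0, hb0])
            (by exact_mod_cast r1) (by exact_mod_cast r2) (by exact_mod_cast r3),
          aux_int_p 4 (by norm_num) (a0 - b0) (a1 - b1) (a2 - b2) (a3 - b3) 0 (-x4) (-x5) (-x6) _
            (by rw [W1, W2]; ext <;> simp) (by simp [ha0, hb0])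
            (by exact_mod_cast r4) (by exact_mod_cast r5) (by exact_mod_cast r6)⟩
      · refine hodd p hp hp2 ⟨?_, ?_, ?_, ?_, ?_, ?_⟩
        · rw [show a1 + b1 = 2 * (b1 + z1) by omega]; exact Dvd.dvd.mul_left d0 2
        · rw [show a2 + b2 = 2 * (b2 + z2) by omega]; exact Dvd.dvd.mul_left d1 2
        · rw [show a3 + b3 = 2 * (b3 + z3) by omega]; exact Dvd.dvd.mul_left d2 2
        · rw [show b1 - a1 = 2 * -z1 by omega]; exact Dvd.dvd.mul_left d3 2
        · rw [show b2 - a2 = 2 * -z2 by omega]; exact Dvd.dvd.mul_left d4 2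
        · rw [show b3 - a3 = 2 * -z3 by omega]; exact Dvd.dvd.mul_left d5 2) l (by
      subst g1 g2 g3
      push_cast at i1 i2 i3 j1 j2 j3
      intro i
      fin_cases i <;> simp <;> linarith)
    rcases this with rfl | rfl
    · left; rw [hl1, hl2, one_smul, one_smul]; exact ⟨rfl, rfl⟩
    · right; rw [hl1, hl2, neg_smul, neg_smul, one_smul, one_smul]; exact ⟨rfl, rfl⟩
  · intro hne
    have := aux_ratio _ (![a1 + b1, a2 + b2, a3 + b3, b1 - a1, b2 - a2, b3 - a3] : Fin 6 → ℤ) hprim (by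
      intro p hp hd
      have d0 : (p : ℤ) ∣ a1 + b1 := hd 0
      have d1 : (p : ℤ) ∣ a2 + b2 := hd 1
      have d2 : (p : ℤ) ∣ a3 + b3 := hd 2
      have d3 : (p : ℤ) ∣ b1 - a1 := hd 3
      have d4 : (p : ℤ) ∣ b2 - a2 := hd 4
      have d5 : (p : ℤ) ∣ b3 - a3 := hd 5
      by_cases hp2 : p = 2
      · subst hp2
        obtain ⟨x4, y4⟩ := d3
        obtain ⟨x5, y5⟩ := d4
        obtain ⟨x6, y6⟩ := d5
        push_cast at y4 y5 y6
        have r4 : a1 - b1 = 2 * -x4 := by omega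
        have r5 : a2 - b2 = 2 * -x5 := by omega
        have r6 : a3 - b3 = 2 * -x6 := by omega
        exact hne (aux_int_p 2 (by norm_num) (a0 - b0) (a1 - b1) (a2 - b2) (a3 - b3) 0
            (-x4) (-x5) (-x6) _
            (by rw [W1, W2]; ext <;> simp) (by simp [ha0, hb0])
            (by exact_mod_cast r4) (by exact_mod_cast r5) (by exact_mod_cast r6))
      · exact hodd p hp hp2 ⟨d0, d1, d2, d3, d4, d5⟩) (l / 2) (by
      intro i
      fin_cases i <;> simp <;> linarith)
    have two : ∀ w : ℍ[ℚ], (2 : ℚ) • w = 2 * w := by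
      intro w; rw [two_smul, two_mul]
    rcases this with h | h
    · left
      have : l = 2 := by linarith
      rw [hl1, hl2, this, two, two]; exact ⟨rfl, rfl⟩
    · right
      have : l = -2 := by linarith
      rw [hl1, hl2, this, neg_smul, neg_smul, two, two]; exact ⟨rfl, rfl⟩
end

section
/- For every positive integer D, the set 𝓡_D is nonempty if and only if D mod 16 ∉ {0, 7, 12, 15}. -/
/-- The standard inner product on `ℚ⁴`. -/
def innerQ4 (x y : Fin 4 → ℚ) : ℚ := ∑ i, x i * y i

/-- A vector of `ℚ⁴` lies in `ℤ⁴`. -/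
def IsIntVec (x : Fin 4 → ℚ) : Prop := ∀ i, ∃ n : ℤ, x i = n

/-- `(v₁, v₂)` is a `ℤ`-basis of the lattice `L ∩ ℤ⁴`. -/
def IsZBasisOf (L : Submodule ℚ (Fin 4 → ℚ)) (v₁ v₂ : Fin 4 → ℚ) : Prop :=
  v₁ ∈ L ∧ v₂ ∈ L ∧ IsIntVec v₁ ∧ IsIntVec v₂ ∧ LinearIndependent ℚ ![v₁, v₂] ∧
    ∀ x ∈ L, IsIntVec x → ∃ m n : ℤ, x = (m : ℚ) • v₁ + (n : ℚ) • v₂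

/-- The determinant of the Gram matrix of the pair `(v₁, v₂)` with respect to the standard
inner product. -/
def gramDet (v₁ v₂ : Fin 4 → ℚ) : ℚ :=
  innerQ4 v₁ v₁ * innerQ4 v₂ v₂ - innerQ4 v₁ v₂ ^ 2

/-- `L` is a 2-dimensional `ℚ`-subspace of `ℚ⁴` of discriminant `D`, i.e. `L ∈ 𝓡_D`. -/
def MemRD (D : ℕ) (L : Submodule ℚ (Fin 4 → ℚ)) : Prop :=
  Module.finrank ℚ L = 2 ∧ ∃ v₁ v₂ : Fin 4 → ℚ, IsZBasisOf L v₁ v₂ ∧ gramDet v₁ v₂ = D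


theorem balance (p q : ℤ) (hp : 0 < p) : ∃ k : ℤ, -p ≤ 2*(q + k*p) ∧ 2*(q+k*p) ≤ p := by
  refine ⟨-((2*q+p)/(2*p)), ?_⟩
  have h1 := Int.mul_ediv_add_emod (2*q+p) (2*p)
  have h2 := Int.emod_nonneg (2*q+p) (b := 2*p) (by omega)
  have h3 := Int.emod_lt_of_pos (2*q+p) (b := 2*p) (by omega)
  constructor <;> nlinarith

theorem binred (D : ℤ) (hD : 0 < D) : ∀ N : ℕ, ∀ p q r : ℤ, p ≤ N → 0 < p → p*r - q^2 = D →
    ∃ α β γ δ : ℤ, α*δ - β*γ = 1 ∧ 0 < p*α^2+2*q*α*γ+r*γ^2 ∧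
      3*(p*α^2+2*q*α*γ+r*γ^2)^2 ≤ 4*D := by
  intro N
  induction N with
  | zero => intro p q r h1 h2; simp at h1; omega
  | succ N ih =>
    intro p q r hN hp hd
    obtain ⟨k, hk1, hk2⟩ := balance p q hp
    obtain ⟨q', hq'⟩ : ∃ q', q' = q + k*p := ⟨_, rfl⟩
    obtain ⟨r', hr'⟩ : ∃ r', r' = r + 2*k*q + k^2*p := ⟨_, rfl⟩
    rw [← hq'] at hk1 hk2
    have hd' : p*r' - q'^2 = D := by subst hq' hr'; linear_combination hd
    have hq2 : 4*q'^2 ≤ p^2 := by nlinarith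
    by_cases h : p ≤ r'
    · refine ⟨1, 0, 0, 1, by ring, by simpa using hp, ?_⟩
      ring_nf
      nlinarith
    · have hr : 0 < r' := by
        by_contra hc
        nlinarith [sq_nonneg q']
      obtain ⟨α, β, γ, δ, h1, h2, h3⟩ := ih r' (-q') p (by push_cast at hN; omega) hr (by linear_combination hd')
      have e : r'*α^2+2*(-q')*α*γ+p*γ^2 = p*(k*α-γ)^2+2*q*(k*α-γ)*α+r*α^2 := by
        subst hq' hr'; ring
      rw [e] at h2 h3
      exact ⟨k*α-γ, k*β-δ, α, β, by linear_combination h1, h2, h3⟩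

def Q3 (a b c r s t : ℤ) : Prop := ∃ u₁ u₂ u₃ v₁ v₂ v₃ w₁ w₂ w₃ : ℤ,
  a = u₁^2+u₂^2+u₃^2 ∧ b = v₁^2+v₂^2+v₃^2 ∧ c = w₁^2+w₂^2+w₃^2 ∧
  r = v₁*w₁+v₂*w₂+v₃*w₃ ∧ s = u₁*w₁+u₂*w₂+u₃*w₃ ∧ t = u₁*v₁+u₂*v₂+u₃*v₃

theorem Q3.swap {a b c r s t : ℤ} (h : Q3 b a c s r t) : Q3 a b c r s t := by
  obtain ⟨u₁, u₂, u₃, v₁, v₂, v₃, w₁, w₂, w₃, h1, h2, h3, h4, h5, h6⟩ := h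
  exact ⟨v₁, v₂, v₃, u₁, u₂, u₃, w₁, w₂, w₃, h2, h1, h3, h5, h4, by linear_combination h6⟩

theorem Q3.shift {a b c r s t : ℤ} (k l : ℤ)
    (h : Q3 a (b+2*k*t+k^2*a) (c+2*l*s+l^2*a) (r+k*s+l*t+k*l*a) (s+l*a) (t+k*a)) :
    Q3 a b c r s t := by
  obtain ⟨u₁, u₂, u₃, v₁, v₂, v₃, w₁, w₂, w₃, h1, h2, h3, h4, h5, h6⟩ := h
  refine ⟨u₁, u₂, u₃, v₁-k*u₁, v₂-k*u₂, v₃-k*u₃, w₁-l*u₁, w₂-l*u₂, w₃-l*u₃, h1, ?_, ?_, ?_, ?_, ?_⟩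
  · linear_combination h2 - 2*k*h6 + k^2*h1
  · linear_combination h3 - 2*l*h5 + l^2*h1
  · linear_combination h4 - k*h5 - l*h6 + k*l*h1
  · linear_combination h5 - l*h1
  · linear_combination h6 - k*h1

theorem Q3.trans {a b c r s t : ℤ} (α β γ δ : ℤ) (hu : α*δ-β*γ = 1)
    (h : Q3 a (b*α^2+2*r*α*γ+c*γ^2) (b*β^2+2*r*β*δ+c*δ^2) (b*α*β+r*(α*δ+β*γ)+c*γ*δ)
      (β*t+δ*s) (α*t+γ*s)) :
    Q3 a b c r s t := by
  obtain ⟨u₁, u₂, u₃, v₁, v₂, v₃, w₁, w₂, w₃, h1, h2, h3, h4, h5, h6⟩ := h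
  have hu2 : (α*δ-β*γ)^2 = 1 := by rw [hu]; ring
  refine ⟨u₁, u₂, u₃, δ*v₁-γ*w₁, δ*v₂-γ*w₂, δ*v₃-γ*w₃, -β*v₁+α*w₁, -β*v₂+α*w₂, -β*v₃+α*w₃, h1, ?_, ?_, ?_, ?_, ?_⟩
  · linear_combination δ^2*h2 + γ^2*h3 - 2*γ*δ*h4 - b*hu2
  · linear_combination β^2*h2 + α^2*h3 - 2*α*β*h4 - c*hu2
  · linear_combination -δ*β*h2 - γ*α*h3 + (δ*α+β*γ)*h4 - r*hu2
  · linear_combination -β*h6+α*h5 - s*hu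
  · linear_combination δ*h6-γ*h5 - t*hu

theorem Q3.of_bin {b c r : ℤ} (hb : 0 < b) (hd : b*c-r^2 = 1) : Q3 1 b c r 0 0 := by
  obtain ⟨α, β, γ, δ, h1, h2, h3⟩ := binred 1 one_pos b.toNat b r c (by omega) hb hd
  apply Q3.trans α β γ δ h1
  have h4 : b*α^2+2*r*α*γ+c*γ^2 = 1 := by nlinarith
  have h5 : (b*α^2+2*r*α*γ+c*γ^2)*(b*β^2+2*r*β*δ+c*δ^2) - (b*α*β+r*(α*δ+β*γ)+c*γ*δ)^2 = 1 := by
    linear_combination (α*δ-β*γ)^2*hd + (α*δ-β*γ+1)*h1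
  rw [h4] at h5 ⊢
  generalize b*β^2+2*r*β*δ+c*δ^2 = c' at *
  generalize b*α*β+r*(α*δ+β*γ)+c*γ*δ = r' at *
  refine ⟨1,0,0,0,1,0,0,r',1, ?_, ?_, ?_, ?_, ?_, ?_⟩ <;> linarith

theorem Q3.main : ∀ N : ℕ, ∀ a b c r s t : ℤ, a ≤ N → 0 < a → 0 < a*b-t^2 →
    a*b*c+2*r*s*t-a*r^2-b*s^2-c*t^2 = 1 → Q3 a b c r s t := by
  intro N
  induction N with
  | zero => intro a b c r s t h1 h2; simp at h1; omega
  | succ N ih =>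
    intro a b c r s t hN ha hg hd
    by_cases ha1 : a = 1
    · subst ha1
      apply Q3.shift (-t) (-s)
      have := Q3.of_bin (b := b-t^2) (c := c-s^2) (r := r-s*t) (by linarith) (by linear_combination hd)
      convert this using 1 <;> ring
    · obtain ⟨α, β, γ, δ, h1, h2, h3⟩ := binred a ha (a*b-t^2).toNat (a*b-t^2) (a*r-t*s) (a*c-s^2)
        (by omega) hg (by linear_combination a*hd)
      apply Q3.trans α β γ δ h1
      have e : (a*b-t^2)*α^2+2*(a*r-t*s)*α*γ+(a*c-s^2)*γ^2 =
        a*(b*α^2+2*r*α*γ+c*γ^2) - (α*t+γ*s)^2 := by ring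
      rw [e] at h2 h3
      have hd' : a*(b*α^2+2*r*α*γ+c*γ^2)*(b*β^2+2*r*β*δ+c*δ^2)+2*(b*α*β+r*(α*δ+β*γ)+c*γ*δ)*(β*t+δ*s)*(α*t+γ*s)
        -a*(b*α*β+r*(α*δ+β*γ)+c*γ*δ)^2-(b*α^2+2*r*α*γ+c*γ^2)*(β*t+δ*s)^2-(b*β^2+2*r*β*δ+c*δ^2)*(α*t+γ*s)^2 = 1 := by
        linear_combination (α*δ-β*γ)^2*hd + (α*δ-β*γ+1)*h1
      generalize b*α^2+2*r*α*γ+c*γ^2 = b' at *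
      generalize b*β^2+2*r*β*δ+c*δ^2 = c' at *
      generalize b*α*β+r*(α*δ+β*γ)+c*γ*δ = r' at *
      generalize β*t+δ*s = s' at *
      generalize α*t+γ*s = t' at *
      obtain ⟨k, hk1, hk2⟩ := balance a t' ha
      apply Q3.shift k 0
      have e2 : a*(b'+2*k*t'+k^2*a) - (t'+k*a)^2 = a*b'-t'^2 := by ring
      rw [← e2] at h2 h3
      have hd2 : a*(b'+2*k*t'+k^2*a)*(c'+2*0*s'+0^2*a)+2*(r'+k*s'+0*t'+k*0*a)*(s'+0*a)*(t'+k*a)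
        -a*(r'+k*s'+0*t'+k*0*a)^2-(b'+2*k*t'+k^2*a)*(s'+0*a)^2-(c'+2*0*s'+0^2*a)*(t'+k*a)^2 = 1 := by
        linear_combination hd'
      generalize b'+2*k*t'+k^2*a = b at *
      generalize c'+2*0*s'+0^2*a = c at *
      generalize r'+k*s'+0*t'+k*0*a = r at *
      generalize s'+0*a = s at *
      generalize t'+k*a = t at *
      apply Q3.swap
      have hb : 0 < b := by
        by_contra hc
        nlinarith [sq_nonneg t]
      have hba : b < a := by
        by_contra hc
        have ht : 4*t^2 ≤ a^2 := by nlinarith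
        have h6 : 3*a^2 ≤ 4*(a*b-t^2) := by nlinarith
        have h7 : (3*a^2)^2 ≤ (4*(a*b-t^2))^2 := by
          apply pow_le_pow_left₀ (by positivity) h6
        have h8 : 27*a^4 ≤ 64 * a := by nlinarith
        have h9 : 27*a^3 ≤ 64 := by nlinarith
        have : 2 ≤ a := by omega
        have : 2^3 ≤ a^3 := pow_le_pow_left₀ (by norm_num) this 3
        linarith
      exact ih b a c s r t (by push_cast at hN; omega) hb (by linarith) (by linear_combination hd2)


theorem three_of_residue (n d x m: ℤ) (hd : 0 < d) (hdn : 0 < d*n-1) (hx : x^2 + d = m*(d*n-1)) :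
    ∃ a b c e f g : ℤ, a^2+b^2+c^2 = n ∧ e*a+f*b+g*c = 1 := by
  have hm : 0 < m := by
    by_contra hc
    nlinarith [sq_nonneg x]
  have hdet : m*(d*n-1)*n+2*0*1*x-m*0^2-(d*n-1)*1^2-n*x^2 = 1 := by linear_combination -n*hx
  obtain ⟨u₁, u₂, u₃, v₁, v₂, v₃, w₁, w₂, w₃, h1, h2, h3, h4, h5, h6⟩ :=
    Q3.main m.toNat m (d*n-1) n 0 1 x (by omega) hm (by linarith) hdet
  set E := u₁*(v₂*w₃-v₃*w₂)-u₂*(v₁*w₃-v₃*w₁)+u₃*(v₁*w₂-v₂*w₁) with hE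
  have hE2 : E*E = 1 := by
    rw [← hdet, hE, h2, h1, h6, h3]
    linear_combination (-2*(u₁*w₁+u₂*w₂+u₃*w₃)*(u₁*v₁+u₂*v₂+u₃*v₃) + (u₁^2+u₂^2+u₃^2)*(v₁*w₁+v₂*w₂+v₃*w₃))*h4 + (v₁^2+v₂^2+v₃^2)*(u₁*w₁+u₂*w₂+u₃*w₃+1)*h5
  refine ⟨w₁, w₂, w₃, E*(u₂*v₃-u₃*v₂), E*(u₃*v₁-u₁*v₃), E*(u₁*v₂-u₂*v₁), h3.symm, ?_⟩
  rw [← hE2]; nth_rw 5 [hE]; ring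

open NumberTheorySymbols in
theorem exists_sqrt (d p : ℕ) (hp : p.Prime) (h : J(-(d:ℤ) | p) = 1) :
    ∃ x : ℤ, (p:ℤ) ∣ x^2 + d := by
  have := Fact.mk hp
  obtain ⟨y, hy⟩ := ZMod.isSquare_of_jacobiSym_eq_one h
  obtain ⟨x, rfl⟩ := ZMod.intCast_surjective y
  refine ⟨x, (ZMod.intCast_zmod_eq_zero_iff_dvd _ _).1 ?_⟩
  push_cast at hy ⊢
  linear_combination -hy

theorem cop_aux (n c k : ℤ) (e : ℤ) (hk : e*k = c*n-1) (hodd : Odd k) : IsCoprime k (4*n) := by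
  apply IsCoprime.mul_right
  · have : IsCoprime k 2 := by
      obtain ⟨m, rfl⟩ := hodd
      exact ⟨1, -m, by ring⟩
    have := IsCoprime.mul_right this this
    norm_num at this
    exact this
  · exact ⟨-e, c, by linear_combination -hk⟩

theorem dirichlet_aux (n k : ℕ) (hn : 0 < n) (h : IsCoprime (k:ℤ) (4*n)) :
    ∃ p j : ℕ, p.Prime ∧ p = 4*n*j + k := by
  obtain ⟨p, hpk, hp, hm⟩ := Nat.forall_exists_prime_gt_and_modEq k (q := 4*n) (a := k) (by omega)
    (by rw [← Nat.isCoprime_iff_coprime]; push_cast; exact h)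
  obtain ⟨j, hj⟩ := (Nat.modEq_iff_dvd' hpk.le).1 hm.symm
  exact ⟨p, j, hp, by omega⟩

open NumberTheorySymbols in
theorem three_even (n : ℕ) (hn : n % 4 = 2) :
    ∃ a b c e f g : ℤ, a^2+b^2+c^2 = n ∧ e*a+f*b+g*c = 1 := by
  obtain ⟨k, rfl⟩ : ∃ k, n = k + 1 := ⟨n-1, by omega⟩
  obtain ⟨p, j, hp, hpj⟩ := dirichlet_aux (k+1) k (by omega)
    (by push_cast; exact cop_aux _ 1 _ 1 (by ring) (by
      have : (k:ℤ) % 2 = 1 := by omega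
      exact Int.odd_iff.2 this))
  have hp4 : p % 4 = 1 := by
    rw [hpj, mul_assoc]; omega
  have hJ : J(-((4*j+1:ℕ):ℤ) | p) = 1 := by
    rw [jacobiSym.neg _ (Nat.odd_iff.2 (by omega)), ZMod.χ₄_nat_one_mod_four hp4, one_mul,
      jacobiSym.quadratic_reciprocity_one_mod_four (by omega) (Nat.odd_iff.2 (by omega))]
    have : J((p:ℤ) | 4*j+1) = J(-1 | 4*j+1) := by
      apply jacobiSym.mod_left'
      apply Int.ModEq.symm
      rw [Int.modEq_iff_dvd]
      exact ⟨k+1, by subst hpj; push_cast; ring⟩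
    rw [this, jacobiSym.at_neg_one (Nat.odd_iff.2 (by omega)), ZMod.χ₄_nat_one_mod_four (by omega)]
  obtain ⟨x, m, hm⟩ := exists_sqrt _ p hp hJ
  have e : (p:ℤ) = ((4*j+1:ℕ):ℤ)*((k+1:ℕ):ℤ)-1 := by subst hpj; push_cast; ring
  refine three_of_residue _ ((4*j+1:ℕ):ℤ) x m (by omega) ?_ ?_
  · rw [← e]; exact_mod_cast hp.pos
  · rw [hm, e]; ring

open NumberTheorySymbols in
theorem three_odd (n c k : ℕ) (hk : 2*k+1 = c*n) (hko : k % 2 = 1) (hn : 0 < n)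
    (hc : c = 1 ∨ c = 3) (hkc : k % 4 = 1 ∨ c = 3) :
    ∃ a b c e f g : ℤ, a^2+b^2+c^2 = n ∧ e*a+f*b+g*c = 1 := by
  have hkZ : 2*(k:ℤ)+1 = c*n := by exact_mod_cast hk
  obtain ⟨p, j, hp, hpj⟩ := dirichlet_aux n k hn
    (cop_aux _ c _ 2 (by linear_combination hkZ) (Int.odd_iff.2 (by omega)))
  have hp4 : p % 4 = k % 4 := by
    rw [hpj, mul_assoc]; omega
  obtain ⟨d, hd⟩ : ∃ d, d = 8*j+c := ⟨_, rfl⟩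
  have e : 2*(p:ℤ) = (d:ℤ)*(n:ℤ)-1 := by subst hpj hd; push_cast; linear_combination hkZ
  have hdo : Odd d := Nat.odd_iff.2 (by omega)
  have hpo : Odd p := Nat.odd_iff.2 (by omega)
  have hpd : J((p:ℤ) | d) = 1 := by
    have h1 : J((4*p:ℤ) | d) = J(-2 | d) := by
      apply jacobiSym.mod_left'
      apply Int.ModEq.symm
      rw [Int.modEq_iff_dvd]
      exact ⟨2*n, by linear_combination 2*e⟩
    rw [jacobiSym.mul_left, jacobiSym.at_four hdo, one_mul, jacobiSym.at_neg_two hdo] at h1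
    rw [h1, ZMod.χ₈'_nat_eq_if_mod_eight]
    have : d % 8 = 1 ∨ d % 8 = 3 := by omega
    have h2 : d % 2 = 1 := by omega
    simp [h2, this]
  have hJ : J(-(d:ℤ) | p) = 1 := by
    rw [jacobiSym.neg _ hpo]
    by_cases h : p % 4 = 1
    · rw [ZMod.χ₄_nat_one_mod_four h, one_mul, jacobiSym.quadratic_reciprocity_one_mod_four' hdo h, hpd]
    · have h3 : p % 4 = 3 := by omega
      rw [ZMod.χ₄_nat_three_mod_four h3, jacobiSym.quadratic_reciprocity_three_mod_four (by omega) h3, hpd]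
      norm_num
  have hx : ∃ x : ℤ, 2*(p:ℤ) ∣ x^2 + d := by
    obtain ⟨x, hx⟩ := exists_sqrt _ p hp hJ
    have h2p : IsCoprime (2:ℤ) p := by
      obtain ⟨m, hm⟩ := hpo
      exact ⟨-m, 1, by rw [hm]; push_cast; ring⟩
    obtain ⟨d', hd'⟩ := hdo
    rcases Int.even_or_odd' x with ⟨y, hy | hy⟩
    · obtain ⟨q, hq⟩ := hpo
      refine ⟨x+p, h2p.mul_dvd ?_ ?_⟩
      · exact ⟨2*y^2+2*y*(2*q+1)+2*q^2+2*q+d'+1, by rw [hy, hq, hd']; push_cast; ring⟩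
      · have : (x+p)^2+(d:ℤ) = x^2+d+p*(2*x+p) := by ring
        rw [this]; exact dvd_add hx (dvd_mul_right _ _)
    · refine ⟨x, h2p.mul_dvd ?_ hx⟩
      exact ⟨2*y^2+2*y+d'+1, by rw [hy, hd']; push_cast; ring⟩
  obtain ⟨x, m, hm⟩ := hx
  refine three_of_residue _ (d:ℤ) x m (by omega) ?_ ?_
  · rw [← e]; have := hp.pos; omega
  · rw [hm, e]; ring

theorem three_sq (n : ℕ) (h : n % 8 = 1 ∨ n % 8 = 2 ∨ n % 8 = 3 ∨ n % 8 = 5 ∨ n % 8 = 6) :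
    ∃ a b c e f g : ℤ, a^2+b^2+c^2 = n ∧ e*a+f*b+g*c = 1 := by
  by_cases h2 : n % 4 = 2
  · exact three_even n h2
  by_cases h3 : n % 8 = 3
  · exact three_odd n 1 ((n-1)/2) (by omega) (by omega) (by omega) (by simp) (by omega)
  · exact three_odd n 3 ((3*n-1)/2) (by omega) (by omega) (by omega) (by simp) (by omega)

theorem mem_aux (D : ℕ) (s t y z e f g : ℤ) (h1 : e*t+f*y+g*z = 1)
    (hD : (1+s^2)*(t^2+y^2+z^2) - s^2*t^2 = D) :
    ∃ L : Submodule ℚ (Fin 4 → ℚ), MemRD D L := by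
  have h1Q : (e:ℚ)*t+f*y+g*z = 1 := by exact_mod_cast h1
  have hDQ : (1+(s:ℚ)^2)*((t:ℚ)^2+y^2+z^2) - s^2*t^2 = D := by exact_mod_cast hD
  let v₁ : Fin 4 → ℚ := ![(s:ℚ), 1, 0, 0]
  let v₂ : Fin 4 → ℚ := ![(t:ℚ), 0, y, z]
  have hli : LinearIndependent ℚ ![v₁, v₂] := by
    rw [LinearIndependent.pair_iff]
    intro α β h
    have e0 := congrFun h 0
    have e1 := congrFun h 1
    have e2 := congrFun h 2
    have e3 := congrFun h 3
    simp [v₁, v₂] at e0 e1 e2 e3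
    subst e1
    refine ⟨rfl, ?_⟩
    have : β = e*(β*t)+f*(β*y)+g*(β*z) := by linear_combination -β*h1Q
    have e0' : β*t = 0 := by linarith
    have e2' : β*y = 0 := by simpa using e2
    have e3' : β*z = 0 := by simpa using e3
    rw [this, e0', e2', e3']; ring
  refine ⟨Submodule.span ℚ (Set.range ![v₁, v₂]), ?_, v₁, v₂, ⟨?_, ?_, ?_, ?_, hli, ?_⟩, ?_⟩
  · rw [finrank_span_eq_card hli]; simp
  · exact Submodule.subset_span ⟨0, rfl⟩
  · exact Submodule.subset_span ⟨1, rfl⟩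
  · intro i
    fin_cases i
    · exact ⟨s, rfl⟩
    · exact ⟨1, by simp [v₁]⟩
    · exact ⟨0, by simp [v₁]⟩
    · exact ⟨0, by simp [v₁]⟩
  · intro i
    fin_cases i
    · exact ⟨t, rfl⟩
    · exact ⟨0, by simp [v₂]⟩
    · exact ⟨y, rfl⟩
    · exact ⟨z, rfl⟩
  · intro x hx hint
    rw [Submodule.mem_span_range_iff_exists_fun] at hx
    obtain ⟨c, hc⟩ := hx
    rw [Fin.sum_univ_two] at hc
    obtain ⟨n0, e0⟩ := hint 0
    obtain ⟨n1, e1⟩ := hint 1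
    obtain ⟨n2, e2⟩ := hint 2
    obtain ⟨n3, e3⟩ := hint 3
    rw [← hc] at e0 e1 e2 e3
    simp [v₁, v₂] at e0 e1 e2 e3
    refine ⟨n1, e*(n0-n1*s)+f*n2+g*n3, ?_⟩
    have : c 1 = ((e*(n0-n1*s)+f*n2+g*n3 : ℤ) : ℚ) := by
      push_cast
      linear_combination -c 1*h1Q + e*e0 - e*s*e1 + f*e2+g*e3
    rw [← this, ← e1, ← hc]
    rfl
  · simp only [gramDet, innerQ4, Fin.sum_univ_four]
    simp [v₁, v₂]
    linear_combination hDQ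

theorem exists_four (D m : ℕ) (hD : D = 4*m) (x y z e f g : ℤ) (hm : x^2+y^2+z^2 = m)
    (h1 : e*x+f*y+g*z = 1) (hxy : (x+y)%2 = 1) :
    ∃ L : Submodule ℚ (Fin 4 → ℚ), MemRD D L := by
  obtain ⟨k, hk⟩ : ∃ k, x+y = 2*k+1 := ⟨(x+y)/2, by omega⟩
  refine mem_aux D 1 (2*z) (x+y) (x-y) (-k*g) (1-k*(e+f)) (-k*(e-f)) ?_ ?_
  · linear_combination hk - 2*k*h1
  · subst hD; push_cast; linear_combination 4*hm

theorem sq_cases (x : ℤ) : x%4=0 ∧ x^2%16=0 ∨ x%4=2 ∧ x^2%16=4 ∨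
    x%2=1 ∧ (x^2%16=1 ∨ x^2%16=9) := by
  have h : x^2 % 16 = ((x%16)^2)%16 := by simp [pow_two, Int.mul_emod]
  have h1 := Int.emod_nonneg x (b := 16) (by norm_num)
  have h2 := Int.emod_lt_of_pos x (b := 16) (by norm_num)
  have h3 : x%4 = x%16%4 := by omega
  have h4 : x%2 = x%16%2 := by omega
  rw [h, h3, h4]
  generalize x%16 = w at *
  interval_cases w <;> simp

theorem exists_back (D : ℕ) (hD : 0 < D) (h : D % 16 ∉ ({0, 7, 12, 15} : Set ℕ)) :
    ∃ L : Submodule ℚ (Fin 4 → ℚ), MemRD D L := by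
  simp only [Set.mem_insert_iff, Set.mem_singleton_iff, not_or] at h
  by_cases h4 : D % 4 = 0
  · obtain ⟨m, rfl⟩ : ∃ m, D = 4*m := ⟨D/4, by omega⟩
    obtain ⟨x, y, z, e, f, g, hm, h1⟩ := three_sq m (by omega)
    by_cases hxy : (x+y)%2=1
    · exact exists_four _ m rfl x y z e f g hm h1 hxy
    by_cases hxz : (x+z)%2=1
    · exact exists_four _ m rfl x z y e g f (by linarith) (by linarith) hxz
    · exfalso
      have := sq_cases x
      have := sq_cases y
      have := sq_cases z
      omega
  · obtain ⟨x, y, z, e, f, g, hm, h1⟩ := three_sq D (by omega)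
    exact mem_aux D 0 x y z e f g h1 (by linear_combination hm)

theorem half_aux (L : Submodule ℚ (Fin 4 → ℚ)) (v₁ v₂ : Fin 4 → ℚ) (h : IsZBasisOf L v₁ v₂)
    (μ ν : ℤ) (w : Fin 4 → ℤ) (hw : ∀ i, (μ:ℚ) * v₁ i + ν * v₂ i = 2 * w i) :
    μ % 2 = 0 ∧ ν % 2 = 0 := by
  obtain ⟨m1, m2, i1, i2, li, hb⟩ := h
  have key : (fun i => (w i : ℚ)) = ((μ:ℚ)/2) • v₁ + ((ν:ℚ)/2) • v₂ := by
    funext i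
    have := hw i
    simp only [Pi.add_apply, Pi.smul_apply, smul_eq_mul]
    linarith
  obtain ⟨m, n, hmn⟩ := hb (fun i => (w i : ℚ))
    (by rw [key]; exact L.add_mem (L.smul_mem _ m1) (L.smul_mem _ m2)) (fun i => ⟨w i, rfl⟩)
  rw [LinearIndependent.pair_iff] at li
  have := li ((μ:ℚ)/2 - m) ((ν:ℚ)/2 - n) (by
    rw [sub_smul, sub_smul]
    rw [key] at hmn
    rw [sub_add_sub_comm, hmn, sub_self])
  obtain ⟨a1, a2⟩ := this
  have b1 : (μ:ℚ) = ((2*m:ℤ):ℚ) := by push_cast; linarith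
  have b2 : (ν:ℚ) = ((2*n:ℤ):ℚ) := by push_cast; linarith
  have c1 := Int.cast_injective b1
  have c2 := Int.cast_injective b2
  omega

theorem parity_aux : ∀ a b : Fin 4 → ZMod 2, (∀ i j, a i * b j - a j * b i = 0) →
    a = 0 ∨ b = 0 ∨ a + b = 0 := by
  intro a b h
  have hz : ∀ x : ZMod 2, x = 0 ∨ x = 1 := by decide
  by_cases ha : a = 0
  · exact Or.inl ha
  right
  obtain ⟨i, hi⟩ := Function.ne_iff.1 ha
  have hi1 : a i = 1 := (hz (a i)).resolve_left hi
  have h' : ∀ j, b j = a j * b i := by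
    intro j
    have := h i j
    rw [hi1] at this
    linear_combination this
  rcases hz (b i) with hb | hb
  · left; funext j; rw [h' j, hb]; simp
  · right; funext j; rw [Pi.add_apply, h' j, hb, mul_one]; exact CharTwo.add_self_eq_zero _

theorem sum_aux (D : ℕ) (hm : D % 16 = 0 ∨ D % 16 = 7 ∨ D % 16 = 12 ∨ D % 16 = 15) (x y z : ℤ)
    (h : x^2+y^2+z^2 = D) :
    (D % 16 = 0 ∧ x%4=0 ∧ y%4=0 ∧ z%4=0) ∨ (D % 16 = 12 ∧ x%4=2 ∧ y%4=2 ∧ z%4=2) := by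
  have s1 := sq_cases x
  have s2 := sq_cases y
  have s3 := sq_cases z
  generalize x^2 = q1 at *
  generalize y^2 = q2 at *
  generalize z^2 = q3 at *
  rcases s1 with ⟨s1, t1⟩ | ⟨s1, t1⟩ | ⟨s1, t1 | t1⟩ <;>
  rcases s2 with ⟨s2, t2⟩ | ⟨s2, t2⟩ | ⟨s2, t2 | t2⟩ <;>
  rcases s3 with ⟨s3, t3⟩ | ⟨s3, t3⟩ | ⟨s3, t3 | t3⟩ <;>
  first
  | (exfalso; omega)
  | (left; exact ⟨by omega, s1, s2, s3⟩)
  | (right; exact ⟨by omega, s1, s2, s3⟩)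

theorem exists_forward (D : ℕ) (L : Submodule ℚ (Fin 4 → ℚ)) (hL : MemRD D L) :
    D % 16 ∉ ({0, 7, 12, 15} : Set ℕ) := by
  obtain ⟨-, v₁, v₂, hb, hg⟩ := hL
  have hb' := hb
  obtain ⟨-, -, i1, i2, -, -⟩ := hb'
  choose a ha using i1
  choose b hbb using i2
  have hD : (a 0^2+a 1^2+a 2^2+a 3^2)*(b 0^2+b 1^2+b 2^2+b 3^2)
      - (a 0*b 0+a 1*b 1+a 2*b 2+a 3*b 3)^2 = (D:ℤ) := by
    simp only [gramDet, innerQ4, Fin.sum_univ_four, ha, hbb] at hg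
    have : (((a 0^2+a 1^2+a 2^2+a 3^2)*(b 0^2+b 1^2+b 2^2+b 3^2)
      - (a 0*b 0+a 1*b 1+a 2*b 2+a 3*b 3)^2 : ℤ):ℚ) = ((D:ℤ):ℚ) := by
      push_cast; linear_combination hg
    exact_mod_cast this
  intro hmem
  simp only [Set.mem_insert_iff, Set.mem_singleton_iff] at hmem
  have hP : ∀ i j, (a i * b j - a j * b i) % 2 = 0 := by
    obtain ⟨p, hp⟩ : ∃ p : Fin 4 → Fin 4 → ℤ, ∀ i j, p i j = a i * b j - a j * b i := ⟨_, fun _ _ => rfl⟩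
    have hA : (p 0 1 + p 2 3)^2+(p 0 2 - p 1 3)^2+(p 0 3 + p 1 2)^2 = D := by
      simp only [hp]; linear_combination hD
    have hB : (p 0 1 - p 2 3)^2+(p 0 2 + p 1 3)^2+(p 0 3 - p 1 2)^2 = D := by
      simp only [hp]; linear_combination hD
    have hA' := sum_aux D hmem _ _ _ hA
    have hB' := sum_aux D hmem _ _ _ hB
    clear hA hB hD
    have r : p 0 1 % 2 = 0 ∧ p 0 2 % 2 = 0 ∧ p 0 3 % 2 = 0 ∧ p 1 2 % 2 = 0 ∧ p 1 3 % 2 = 0 ∧ p 2 3 % 2 = 0 := by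
      rcases hA' with hA' | hA' <;> rcases hB' with hB' | hB' <;> omega
    have anti : ∀ i j, p i j = - p j i := by intro i j; rw [hp, hp]; ring
    intro i j
    rw [← hp]
    have z : ∀ i, p i i = 0 := by intro i; rw [hp]; ring
    have t10 := anti 1 0
    have t20 := anti 2 0
    have t30 := anti 3 0
    have t21 := anti 2 1
    have t31 := anti 3 1
    have t32 := anti 3 2
    have z0 := z 0
    have z1 := z 1
    have z2 := z 2
    have z3 := z 3
    fin_cases i <;> fin_cases j <;> simp only [Fin.zero_eta, Fin.mk_one, Fin.reduceFinMk] <;> omega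
  have hev : ∀ x : ℤ, (x : ZMod 2) = 0 ↔ x % 2 = 0 := by
    intro x
    rw [ZMod.intCast_zmod_eq_zero_iff_dvd]; omega
  have fin : ∀ μ ν : ℤ, (∀ i, (μ * a i + ν * b i) % 2 = 0) → μ % 2 = 0 ∧ ν % 2 = 0 := by
    intro μ ν h
    apply half_aux L v₁ v₂ hb μ ν (fun i => (μ * a i + ν * b i) / 2)
    intro i
    rw [ha, hbb]
    have : μ * a i + ν * b i = 2 * ((μ * a i + ν * b i) / 2) := by have := h i; omega
    exact_mod_cast this
  rcases parity_aux (fun i => (a i : ZMod 2)) (fun i => (b i : ZMod 2)) (by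
    intro i j
    have := (hev _).2 (hP i j)
    push_cast at this
    exact this) with h | h | h
  · have := fin 1 0 (fun i => by
      have := (hev _).1 (congrFun h i)
      omega)
    omega
  · have := fin 0 1 (fun i => by
      have := (hev _).1 (congrFun h i)
      omega)
    omega
  · have := fin 1 1 (fun i => by
      have h2 := congrFun h i
      have := (hev (a i + b i)).1 (by push_cast; exact h2)
      omega)
    omega

/-- For every positive integer `D`, the set `𝓡_D` of rational planes of
discriminant `D` is nonempty if and only if `D mod 16 ∉ {0, 7, 12, 15}`. -/
theorem stmt_10 (D : ℕ) (hD : 0 < D) :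
    (∃ L : Submodule ℚ (Fin 4 → ℚ), MemRD D L) ↔
      D % 16 ∉ ({0, 7, 12, 15} : Set ℕ) := by
  exact ⟨fun ⟨L, hL⟩ => exists_forward D L hL, exists_back D hD⟩
end

section
/- Let p be an odd prime, L a 2-dimensional ℚ-subspace of ℚ⁴, and (v₁,v₂) a ℤ-basis of L ∩ ℤ⁴. Set a = Nr(v₁), b = 2⟨v₁,v₂⟩, c = Nr(v₂), and let a₁ = a₁(v₁,v₂), a₂ = a₂(v₁,v₂) (these are nonzero integer vectors since Nr(a₁) = Nr(a₂) = disc(L) > 0). Then min(v_p(a), v_p(b), v_p(c)) = max(v_p(a₁), v_p(a₂)), with the convention v_p(0) = +∞. -/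
open Quaternion

/-- The `p`-adic valuation (with values in `ℕ∞`, so `v_p 0 = ⊤`) of an integer vector
`x ∈ ℤ⁴ ⊆ ℍ(ℚ)`: the minimum of the `p`-adic valuations of its four coordinates. -/
noncomputable def vpQuat (p : ℕ) (x : ℍ[ℚ]) : ℕ∞ :=
  min (min (emultiplicity (p : ℤ) x.re.num) (emultiplicity (p : ℤ) x.imI.num))
    (min (emultiplicity (p : ℤ) x.imJ.num) (emultiplicity (p : ℤ) x.imK.num))

theorem core_prod (x0 x1 x2 x3 y0 y1 y2 y3 A1 A2 A3 B1 B2 B3 a t c N : ℤ)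
    (hA1 : A1 = -x0*y1 + x1*y0 - x2*y3 + x3*y2) (hA2 : A2 = -x0*y2 + x1*y3 + x2*y0 - x3*y1)
    (hA3 : A3 = -x0*y3 - x1*y2 + x2*y1 + x3*y0)
    (hB1 : B1 = -x0*y1 + x1*y0 + x2*y3 - x3*y2) (hB2 : B2 = -x0*y2 - x1*y3 + x2*y0 + x3*y1)
    (hB3 : B3 = -x0*y3 + x1*y2 - x2*y1 + x3*y0)
    (ha : a = x0*x0 + x1*x1 + x2*x2 + x3*x3) (ht : t = x0*y0 + x1*y1 + x2*y2 + x3*y3)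
    (hc : c = y0*y0 + y1*y1 + y2*y2 + y3*y3)
    (da : N ∣ a) (dt : N ∣ t) (dc : N ∣ c) :
    (N ∣ 2 * (A1 * B1) ∧ N ∣ 2 * (A1 * B2) ∧ N ∣ 2 * (A1 * B3)) ∧
    (N ∣ 2 * (A2 * B1) ∧ N ∣ 2 * (A2 * B2) ∧ N ∣ 2 * (A2 * B3)) ∧
    (N ∣ 2 * (A3 * B1) ∧ N ∣ 2 * (A3 * B2) ∧ N ∣ 2 * (A3 * B3)) := by
  have key : ∀ u v w : ℤ, N ∣ -(c * u + a * v - 2 * t * w) := fun u v w =>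
    (((dc.mul_right u).add (da.mul_right v)).sub ((dt.mul_left 2).mul_right w)).neg_right
  refine ⟨⟨?_, ?_, ?_⟩, ⟨?_, ?_, ?_⟩, ⟨?_, ?_, ?_⟩⟩
  · have h := key (0 - x0*x0 - x1*x1 + x2*x2 + x3*x3) (0 - y0*y0 - y1*y1 + y2*y2 + y3*y3)
      (0 - x0*y0 - x1*y1 + x2*y2 + x3*y3)
    convert h using 1
    subst_vars; ring
  · have h := key (0 + x3*x0 - x2*x1 - x1*x2 + x0*x3) (0 + y3*y0 - y2*y1 - y1*y2 + y0*y3)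
      (0 + x3*y0 - x2*y1 - x1*y2 + x0*y3)
    convert h using 1
    subst_vars; ring
  · have h := key (0 - x2*x0 - x3*x1 - x0*x2 - x1*x3) (0 - y2*y0 - y3*y1 - y0*y2 - y1*y3)
      (0 - x2*y0 - x3*y1 - x0*y2 - x1*y3)
    convert h using 1
    subst_vars; ring
  · have h := key (0 - x3*x0 - x2*x1 - x1*x2 - x0*x3) (0 - y3*y0 - y2*y1 - y1*y2 - y0*y3)
      (0 - x3*y0 - x2*y1 - x1*y2 - x0*y3)
    convert h using 1
    subst_vars; ring
  · have h := key (0 - x0*x0 + x1*x1 - x2*x2 + x3*x3) (0 - y0*y0 + y1*y1 - y2*y2 + y3*y3)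
      (0 - x0*y0 + x1*y1 - x2*y2 + x3*y3)
    convert h using 1
    subst_vars; ring
  · have h := key (0 + x1*x0 + x0*x1 - x3*x2 - x2*x3) (0 + y1*y0 + y0*y1 - y3*y2 - y2*y3)
      (0 + x1*y0 + x0*y1 - x3*y2 - x2*y3)
    convert h using 1
    subst_vars; ring
  · have h := key (0 + x2*x0 - x3*x1 + x0*x2 - x1*x3) (0 + y2*y0 - y3*y1 + y0*y2 - y1*y3)
      (0 + x2*y0 - x3*y1 + x0*y2 - x1*y3)
    convert h using 1
    subst_vars; ring
  · have h := key (0 - x1*x0 - x0*x1 - x3*x2 - x2*x3) (0 - y1*y0 - y0*y1 - y3*y2 - y2*y3)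
      (0 - x1*y0 - x0*y1 - x3*y2 - x2*y3)
    convert h using 1
    subst_vars; ring
  · have h := key (0 - x0*x0 + x1*x1 + x2*x2 - x3*x3) (0 - y0*y0 + y1*y1 + y2*y2 - y3*y3)
      (0 - x0*y0 + x1*y1 + x2*y2 - x3*y3)
    convert h using 1
    subst_vars; ring

theorem core_back (x0 x1 x2 x3 y0 y1 y2 y3 A1 A2 A3 B1 B2 B3 a t c N : ℤ)
    (hA1 : A1 = -x0*y1 + x1*y0 - x2*y3 + x3*y2) (hA2 : A2 = -x0*y2 + x1*y3 + x2*y0 - x3*y1)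
    (hA3 : A3 = -x0*y3 - x1*y2 + x2*y1 + x3*y0)
    (hB1 : B1 = -x0*y1 + x1*y0 + x2*y3 - x3*y2) (hB2 : B2 = -x0*y2 - x1*y3 + x2*y0 + x3*y1)
    (hB3 : B3 = -x0*y3 + x1*y2 - x2*y1 + x3*y0)
    (ha : a = x0*x0 + x1*x1 + x2*x2 + x3*x3) (ht : t = x0*y0 + x1*y1 + x2*y2 + x3*y3)
    (hc : c = y0*y0 + y1*y1 + y2*y2 + y3*y3)
    (H : ∀ m n : ℤ, N ∣ m*x0 + n*y0 → N ∣ m*x1 + n*y1 → N ∣ m*x2 + n*y2 → N ∣ m*x3 + n*y3 →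
      N ∣ m ∧ N ∣ n)
    (h : (N ∣ A1 ∧ N ∣ A2 ∧ N ∣ A3) ∨ (N ∣ B1 ∧ N ∣ B2 ∧ N ∣ B3)) :
    N ∣ a ∧ N ∣ t ∧ N ∣ c := by
  rcases h with ⟨d1, d2, d3⟩ | ⟨d1, d2, d3⟩
  · have key : ∀ u v w : ℤ, N ∣ A1 * u + A2 * v + A3 * w := fun u v w =>
      ((d1.mul_right u).add (d2.mul_right v)).add (d3.mul_right w)
    have h1 := H c (-t)
      (by convert key (-y1) (-y2) (-y3) using 1; subst_vars; ring)
      (by convert key (y0) (y3) (-y2) using 1; subst_vars; ring)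
      (by convert key (-y3) (y0) (y1) using 1; subst_vars; ring)
      (by convert key (y2) (-y1) (y0) using 1; subst_vars; ring)
    have h2 := H (-t) a
      (by convert key (x1) (x2) (x3) using 1; subst_vars; ring)
      (by convert key (-x0) (-x3) (x2) using 1; subst_vars; ring)
      (by convert key (x3) (-x0) (-x1) using 1; subst_vars; ring)
      (by convert key (-x2) (x1) (-x0) using 1; subst_vars; ring)
    exact ⟨h2.2, (dvd_neg.mp h2.1), h1.1⟩
  · have key : ∀ u v w : ℤ, N ∣ B1 * u + B2 * v + B3 * w := fun u v w =>
      ((d1.mul_right u).add (d2.mul_right v)).add (d3.mul_right w)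
    have h1 := H c (-t)
      (by convert key (-y1) (-y2) (-y3) using 1; subst_vars; ring)
      (by convert key (y0) (-y3) (y2) using 1; subst_vars; ring)
      (by convert key (y3) (y0) (-y1) using 1; subst_vars; ring)
      (by convert key (-y2) (y1) (y0) using 1; subst_vars; ring)
    have h2 := H (-t) a
      (by convert key (x1) (x2) (x3) using 1; subst_vars; ring)
      (by convert key (-x0) (x3) (-x2) using 1; subst_vars; ring)
      (by convert key (-x3) (-x0) (x1) using 1; subst_vars; ring)
      (by convert key (x2) (-x1) (-x0) using 1; subst_vars; ring)
    exact ⟨h2.2, (dvd_neg.mp h2.1), h1.1⟩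

theorem core_prim (x0 x1 x2 x3 y0 y1 y2 y3 A1 A2 A3 B1 B2 B3 p : ℤ) (hp : Prime p)
    (h2 : IsCoprime p 2)
    (hA1 : A1 = -x0*y1 + x1*y0 - x2*y3 + x3*y2) (hA2 : A2 = -x0*y2 + x1*y3 + x2*y0 - x3*y1)
    (hA3 : A3 = -x0*y3 - x1*y2 + x2*y1 + x3*y0)
    (hB1 : B1 = -x0*y1 + x1*y0 + x2*y3 - x3*y2) (hB2 : B2 = -x0*y2 - x1*y3 + x2*y0 + x3*y1)
    (hB3 : B3 = -x0*y3 + x1*y2 - x2*y1 + x3*y0)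
    (H : ∀ m n : ℤ, p ∣ m*x0 + n*y0 → p ∣ m*x1 + n*y1 → p ∣ m*x2 + n*y2 → p ∣ m*x3 + n*y3 →
      p ∣ m ∧ p ∣ n)
    (hA : p ∣ A1 ∧ p ∣ A2 ∧ p ∣ A3) (hB : p ∣ B1 ∧ p ∣ B2 ∧ p ∣ B3) : False := by
  obtain ⟨a1, a2, a3⟩ := hA
  obtain ⟨b1, b2, b3⟩ := hB
  have m01 : p ∣ y0 * x1 + -x0 * y1 := h2.dvd_of_dvd_mul_left (by
    convert a1.add b1 using 1; subst_vars; ring)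
  have m02 : p ∣ y0 * x2 + -x0 * y2 := h2.dvd_of_dvd_mul_left (by
    convert a2.add b2 using 1; subst_vars; ring)
  have m03 : p ∣ y0 * x3 + -x0 * y3 := h2.dvd_of_dvd_mul_left (by
    convert a3.add b3 using 1; subst_vars; ring)
  have m23 : p ∣ y2 * x3 + -x2 * y3 := h2.dvd_of_dvd_mul_left (by
    convert a1.sub b1 using 1; subst_vars; ring)
  have m13 : p ∣ y1 * x3 + -x1 * y3 := h2.dvd_of_dvd_mul_left (by
    convert b2.sub a2 using 1; subst_vars; ring)
  have m12 : p ∣ y1 * x2 + -x1 * y2 := h2.dvd_of_dvd_mul_left (by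
    convert a3.sub b3 using 1; subst_vars; ring)
  have sw : ∀ u v u' v' : ℤ, p ∣ u * v' + -u' * v → p ∣ v * u' + -v' * u := fun u v u' v' h => by
    have e : v * u' + -v' * u = -(u * v' + -u' * v) := by ring
    rw [e]; exact dvd_neg.mpr h
  have z : ∀ u v : ℤ, p ∣ u * v + -v * u := fun u v => by
    have : u * v + -v * u = 0 := by ring
    rw [this]; exact dvd_zero _
  have e0 := (H y0 (-x0) (z _ _) m01 m02 m03).2
  have e1 := (H y1 (-x1) (sw _ _ _ _ m01) (z _ _) m12 m13).2
  have e2 := (H y2 (-x2) (sw _ _ _ _ m02) (sw _ _ _ _ m12) (z _ _) m23).2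
  have e3 := (H y3 (-x3) (sw _ _ _ _ m03) (sw _ _ _ _ m13) (sw _ _ _ _ m23) (z _ _)).2
  rw [dvd_neg] at e0 e1 e2 e3
  have := (H 1 0 (by simpa using e0) (by simpa using e1) (by simpa using e2)
    (by simpa using e3)).1
  exact hp.not_isUnit (isUnit_of_dvd_one this)

theorem core_iff (x0 x1 x2 x3 y0 y1 y2 y3 A1 A2 A3 B1 B2 B3 a t c p : ℤ) (k : ℕ) (hp : Prime p)
    (h2 : IsCoprime p 2)
    (hA1 : A1 = -x0*y1 + x1*y0 - x2*y3 + x3*y2) (hA2 : A2 = -x0*y2 + x1*y3 + x2*y0 - x3*y1)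
    (hA3 : A3 = -x0*y3 - x1*y2 + x2*y1 + x3*y0)
    (hB1 : B1 = -x0*y1 + x1*y0 + x2*y3 - x3*y2) (hB2 : B2 = -x0*y2 - x1*y3 + x2*y0 + x3*y1)
    (hB3 : B3 = -x0*y3 + x1*y2 - x2*y1 + x3*y0)
    (ha : a = x0*x0 + x1*x1 + x2*x2 + x3*x3) (ht : t = x0*y0 + x1*y1 + x2*y2 + x3*y3)
    (hc : c = y0*y0 + y1*y1 + y2*y2 + y3*y3)
    (H : ∀ N m n : ℤ, N ≠ 0 → N ∣ m*x0 + n*y0 → N ∣ m*x1 + n*y1 → N ∣ m*x2 + n*y2 →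
      N ∣ m*x3 + n*y3 → N ∣ m ∧ N ∣ n) :
    (p ^ k ∣ a ∧ p ^ k ∣ 2 * t ∧ p ^ k ∣ c) ↔
      (p ^ k ∣ A1 ∧ p ^ k ∣ A2 ∧ p ^ k ∣ A3) ∨ (p ^ k ∣ B1 ∧ p ^ k ∣ B2 ∧ p ^ k ∣ B3) := by
  have hk2 : IsCoprime (p ^ k) 2 := h2.pow_left
  constructor
  · rintro ⟨da, dt, dc⟩
    have dt' : p ^ k ∣ t := hk2.dvd_of_dvd_mul_left dt
    obtain ⟨⟨q11, q12, q13⟩, ⟨q21, q22, q23⟩, ⟨q31, q32, q33⟩⟩ :=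
      core_prod x0 x1 x2 x3 y0 y1 y2 y3 A1 A2 A3 B1 B2 B3 a t c (p ^ k) hA1 hA2 hA3 hB1 hB2 hB3
        ha ht hc da dt' dc
    have cop : ∀ u : ℤ, ¬ p ∣ u → IsCoprime (p ^ k) u := fun u hu =>
      ((hp.irreducible.coprime_iff_not_dvd).2 hu).pow_left
    have L : ∀ u v : ℤ, ¬ p ∣ v → p ^ k ∣ 2 * (u * v) → p ^ k ∣ u := fun u v hv h =>
      (cop v hv).dvd_of_dvd_mul_right (hk2.dvd_of_dvd_mul_left h)
    have R : ∀ u v : ℤ, ¬ p ∣ u → p ^ k ∣ 2 * (u * v) → p ^ k ∣ v := fun u v hu h =>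
      (cop u hu).dvd_of_dvd_mul_left (hk2.dvd_of_dvd_mul_left h)
    by_cases b1 : p ∣ B1
    · by_cases b2 : p ∣ B2
      · by_cases b3 : p ∣ B3
        · right
          by_cases a1 : p ∣ A1
          · by_cases a2 : p ∣ A2
            · by_cases a3 : p ∣ A3
              · exact (core_prim x0 x1 x2 x3 y0 y1 y2 y3 A1 A2 A3 B1 B2 B3 p hp h2 hA1 hA2 hA3
                  hB1 hB2 hB3 (fun m n => H p m n hp.ne_zero) ⟨a1, a2, a3⟩ ⟨b1, b2, b3⟩).elim
              · exact ⟨R _ _ a3 q31, R _ _ a3 q32, R _ _ a3 q33⟩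
            · exact ⟨R _ _ a2 q21, R _ _ a2 q22, R _ _ a2 q23⟩
          · exact ⟨R _ _ a1 q11, R _ _ a1 q12, R _ _ a1 q13⟩
        · left; exact ⟨L _ _ b3 q13, L _ _ b3 q23, L _ _ b3 q33⟩
      · left; exact ⟨L _ _ b2 q12, L _ _ b2 q22, L _ _ b2 q32⟩
    · left; exact ⟨L _ _ b1 q11, L _ _ b1 q21, L _ _ b1 q31⟩
  · intro h
    obtain ⟨d1, d2, d3⟩ := core_back x0 x1 x2 x3 y0 y1 y2 y3 A1 A2 A3 B1 B2 B3 a t c (p ^ k)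
      hA1 hA2 hA3 hB1 hB2 hB3 ha ht hc (fun m n => H _ m n (pow_ne_zero _ hp.ne_zero)) h
    exact ⟨d1, d2.mul_left 2, d3⟩

theorem vp_le (p k : ℕ) (x : ℍ[ℚ]) (A1 A2 A3 : ℤ) (h0 : x.re = 0) (h1 : x.imI = A1)
    (h2 : x.imJ = A2) (h3 : x.imK = A3) :
    (k : ℕ∞) ≤ vpQuat p x ↔ (p : ℤ) ^ k ∣ A1 ∧ (p : ℤ) ^ k ∣ A2 ∧ (p : ℤ) ^ k ∣ A3 := by
  simp [vpQuat, h0, h1, h2, h3, pow_dvd_iff_le_emultiplicity]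

theorem basis_div (L : Submodule ℚ ℍ[ℚ]) (v₁ v₂ : ℍ[ℚ]) (hbasis : IsZBasisQuat L v₁ v₂)
    (x0 x1 x2 x3 y0 y1 y2 y3 : ℤ)
    (hx0 : v₁.re = x0) (hx1 : v₁.imI = x1) (hx2 : v₁.imJ = x2) (hx3 : v₁.imK = x3)
    (hy0 : v₂.re = y0) (hy1 : v₂.imI = y1) (hy2 : v₂.imJ = y2) (hy3 : v₂.imK = y3) (N m n : ℤ) (hN : N ≠ 0)
    (d0 : N ∣ m*x0 + n*y0) (d1 : N ∣ m*x1 + n*y1) (d2 : N ∣ m*x2 + n*y2)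
    (d3 : N ∣ m*x3 + n*y3) : N ∣ m ∧ N ∣ n := by
  obtain ⟨m1, m2, -, -, li, hb⟩ := hbasis
  have hN' : (N : ℚ) ≠ 0 := by exact_mod_cast hN
  have aux : ∀ x y : ℤ, N ∣ m*x + n*y → ∃ z : ℤ, (m / N : ℚ) * x + (n / N : ℚ) * y = z := by
    rintro x y ⟨z, hz⟩
    refine ⟨z, ?_⟩
    have : (m * x + n * y : ℚ) = N * z := by exact_mod_cast hz
    field_simp
    linarith
  obtain ⟨z0, e0⟩ := aux _ _ d0
  obtain ⟨z1, e1⟩ := aux _ _ d1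
  obtain ⟨z2, e2⟩ := aux _ _ d2
  obtain ⟨z3, e3⟩ := aux _ _ d3
  obtain ⟨m', n', h⟩ := hb ((m / N : ℚ) • v₁ + (n / N : ℚ) • v₂)
    (L.add_mem (L.smul_mem _ m1) (L.smul_mem _ m2))
    ⟨z0, z1, z2, z3, by simpa [hx0, hx1, hx2, hx3, hy0, hy1, hy2, hy3] using e0, by simpa [hx0, hx1, hx2, hx3, hy0, hy1, hy2, hy3] using e1,
      by simpa [hx0, hx1, hx2, hx3, hy0, hy1, hy2, hy3] using e2, by simpa [hx0, hx1, hx2, hx3, hy0, hy1, hy2, hy3] using e3⟩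
  obtain ⟨r1, r2⟩ := LinearIndependent.eq_of_pair li h
  rw [div_eq_iff hN'] at r1 r2
  refine ⟨⟨m', ?_⟩, ⟨n', ?_⟩⟩
  · rw [mul_comm]; exact_mod_cast r1
  · rw [mul_comm]; exact_mod_cast r2

/-- Let `p` be an odd prime, `L` a 2-dimensional `ℚ`-subspace of
`ℍ(ℚ) ≅ ℚ⁴` and `(v₁, v₂)` a `ℤ`-basis of `L ∩ ℤ⁴`.  With `a = Nr v₁`, `b = 2⟨v₁,v₂⟩`,
`c = Nr v₂` and the associated points `a₁ = Im(v₁ conj v₂)`, `a₂ = Im(conj v₂ v₁)`, one has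
`min (v_p a) (v_p b) (v_p c) = max (v_p a₁) (v_p a₂)` (with `v_p 0 = ⊤`). -/
theorem stmt_13 (p : ℕ) (hp : p.Prime) (hp2 : p ≠ 2)
    (L : Submodule ℚ ℍ[ℚ]) (hdim : Module.finrank ℚ L = 2) (v₁ v₂ : ℍ[ℚ])
    (hbasis : IsZBasisQuat L v₁ v₂)
    (a b c : ℤ) (ha : (a : ℚ) = Quaternion.normSq v₁)
    (hb : (b : ℚ) = 2 * (v₁ * star v₂).re) (hc : (c : ℚ) = Quaternion.normSq v₂) :
    min (emultiplicity (p : ℤ) a) (min (emultiplicity (p : ℤ) b) (emultiplicity (p : ℤ) c)) =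
      max (vpQuat p ((v₁ * star v₂).im)) (vpQuat p ((star v₂ * v₁).im)) := by
  obtain ⟨x0, x1, x2, x3, hx0, hx1, hx2, hx3⟩ := hbasis.2.2.1
  obtain ⟨y0, y1, y2, y3, hy0, hy1, hy2, hy3⟩ := hbasis.2.2.2.1
  have hpi : Prime (p : ℤ) := Nat.prime_iff_prime_int.mp hp
  have h2 : IsCoprime (p : ℤ) 2 := by
    have := (Nat.coprime_primes hp Nat.prime_two).2 hp2
    exact_mod_cast Nat.isCoprime_iff_coprime.2 this
  have ha' : a = x0*x0 + x1*x1 + x2*x2 + x3*x3 := by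
    have : (a : ℚ) = x0*x0 + x1*x1 + x2*x2 + x3*x3 := by
      rw [ha, Quaternion.normSq_def', hx0, hx1, hx2, hx3]; ring
    exact_mod_cast this
  have hc' : c = y0*y0 + y1*y1 + y2*y2 + y3*y3 := by
    have : (c : ℚ) = y0*y0 + y1*y1 + y2*y2 + y3*y3 := by
      rw [hc, Quaternion.normSq_def', hy0, hy1, hy2, hy3]; ring
    exact_mod_cast this
  have hb' : b = 2 * (x0*y0 + x1*y1 + x2*y2 + x3*y3) := by
    have : (b : ℚ) = 2 * (x0*y0 + x1*y1 + x2*y2 + x3*y3) := by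
      rw [hb, Quaternion.re_mul]
      simp only [Quaternion.re_star, Quaternion.imI_star, Quaternion.imJ_star,
        Quaternion.imK_star, hx0, hx1, hx2, hx3, hy0, hy1, hy2, hy3]; ring
    exact_mod_cast this
  refine ENat.eq_of_forall_natCast_le_iff fun k => ?_
  rw [le_max_iff, le_min_iff, le_min_iff, ← pow_dvd_iff_le_emultiplicity,
    ← pow_dvd_iff_le_emultiplicity, ← pow_dvd_iff_le_emultiplicity,
    vp_le p k ((v₁ * star v₂).im) (-x0*y1 + x1*y0 - x2*y3 + x3*y2)
      (-x0*y2 + x1*y3 + x2*y0 - x3*y1) (-x0*y3 - x1*y2 + x2*y1 + x3*y0)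
      (by simp) (by simp [hx0, hx1, hx2, hx3, hy0, hy1, hy2, hy3] <;> ring) (by simp [hx0, hx1, hx2, hx3, hy0, hy1, hy2, hy3] <;> ring)
      (by simp [hx0, hx1, hx2, hx3, hy0, hy1, hy2, hy3] <;> ring),
    vp_le p k ((star v₂ * v₁).im) (-x0*y1 + x1*y0 + x2*y3 - x3*y2)
      (-x0*y2 - x1*y3 + x2*y0 + x3*y1) (-x0*y3 + x1*y2 - x2*y1 + x3*y0)
      (by simp) (by simp [hx0, hx1, hx2, hx3, hy0, hy1, hy2, hy3] <;> ring) (by simp [hx0, hx1, hx2, hx3, hy0, hy1, hy2, hy3] <;> ring)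
      (by simp [hx0, hx1, hx2, hx3, hy0, hy1, hy2, hy3] <;> ring), hb']
  exact core_iff x0 x1 x2 x3 y0 y1 y2 y3 _ _ _ _ _ _ a _ c p k hpi h2 rfl rfl rfl rfl rfl rfl
    ha' rfl hc' (basis_div L v₁ v₂ hbasis x0 x1 x2 x3 y0 y1 y2 y3 hx0 hx1 hx2 hx3
      hy0 hy1 hy2 hy3)
end

section
/- Let p be an odd prime and L a 2-dimensional ℚ-subspace of ℚ⁴ with Λ = L ∩ ℤ⁴ and D = disc(L). Let (v₁,v₂) be a ℤ-basis of Λ, let a₁ = a₁(v₁,v₂) and a₂ = a₂(v₁,v₂), and set k = max(v_p(a₁), v_p(a₂)) and n = v_p(D). Then the subgroup of elements of p-power order of the glue group 𝒢(Λ) = Λ*/Λ is isomorphic, as an abelian group, to (ℤ/p^k ℤ) × (ℤ/p^{n−k} ℤ). -/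
open Quaternion

theorem IsIntegerQuat.add {x y : ℍ[ℚ]} (hx : IsIntegerQuat x) (hy : IsIntegerQuat y) :
    IsIntegerQuat (x + y) := by
  obtain ⟨a, b, c, d, h1, h2, h3, h4⟩ := hx
  obtain ⟨a', b', c', d', g1, g2, g3, g4⟩ := hy
  exact ⟨a + a', b + b', c + c', d + d', by simp [h1, g1], by simp [h2, g2],
    by simp [h3, g3], by simp [h4, g4]⟩

theorem IsIntegerQuat.neg {x : ℍ[ℚ]} (hx : IsIntegerQuat x) : IsIntegerQuat (-x) := by
  obtain ⟨a, b, c, d, h1, h2, h3, h4⟩ := hx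
  exact ⟨-a, -b, -c, -d, by simp [h1], by simp [h2], by simp [h3], by simp [h4]⟩

theorem IsIntegerQuat.zero : IsIntegerQuat (0 : ℍ[ℚ]) :=
  ⟨0, 0, 0, 0, by simp, by simp, by simp, by simp⟩

/-- The lattice `Λ = L ∩ ℤ⁴`, as an additive subgroup of `ℍ(ℚ)`. -/
def latticeIn (L : Submodule ℚ ℍ[ℚ]) : AddSubgroup ℍ[ℚ] where
  carrier := {x | x ∈ L ∧ IsIntegerQuat x}
  add_mem' := by
    rintro x y ⟨hxL, hx⟩ ⟨hyL, hy⟩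
    exact ⟨L.add_mem hxL hyL, hx.add hy⟩
  zero_mem' := ⟨L.zero_mem, IsIntegerQuat.zero⟩
  neg_mem' := by
    rintro x ⟨hxL, hx⟩
    exact ⟨L.neg_mem hxL, hx.neg⟩

/-- The dual lattice `Λ* = {x ∈ L : ⟨x, w⟩ ∈ ℤ for all w ∈ Λ}`, as an additive subgroup of
`ℍ(ℚ)`; the inner product is `⟨x, w⟩ = re (x * conj w)`. -/
def dualLatticeIn (L : Submodule ℚ ℍ[ℚ]) : AddSubgroup ℍ[ℚ] where
  carrier := {x | x ∈ L ∧ ∀ w ∈ latticeIn L, ∃ m : ℤ, (x * star w).re = m}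
  add_mem' := by
    rintro x y ⟨hxL, hx⟩ ⟨hyL, hy⟩
    refine ⟨L.add_mem hxL hyL, fun w hw => ?_⟩
    obtain ⟨m, hm⟩ := hx w hw
    obtain ⟨n, hn⟩ := hy w hw
    exact ⟨m + n, by simp [add_mul, hm, hn]⟩
  zero_mem' := ⟨L.zero_mem, fun w _ => ⟨0, by simp⟩⟩
  neg_mem' := by
    rintro x ⟨hxL, hx⟩
    refine ⟨L.neg_mem hxL, fun w hw => ?_⟩
    obtain ⟨m, hm⟩ := hx w hw
    exact ⟨-m, by simp [hm]⟩

/-- The glue group `𝒢(Λ) = Λ*/Λ` of the lattice `Λ = L ∩ ℤ⁴`. -/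
def glueGroup (L : Submodule ℚ ℍ[ℚ]) : Type :=
  ↥(dualLatticeIn L) ⧸ (latticeIn L).addSubgroupOf (dualLatticeIn L)

noncomputable instance (L : Submodule ℚ ℍ[ℚ]) : AddCommGroup (glueGroup L) :=
  QuotientAddGroup.Quotient.addCommGroup _

lemma aux_fwd1 (q a b c d e f g h : ℤ)
    (hind : ∀ x y : ℤ, q ∣ x*a + y*e → q ∣ x*b + y*f → q ∣ x*c + y*g → q ∣ x*d + y*h →
      q ∣ x ∧ q ∣ y)
    (h1 : q ∣ -a*f + b*e - c*h + d*g) (h2 : q ∣ -a*g + b*h + c*e - d*f)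
    (h3 : q ∣ -a*h - b*g + c*f + d*e) :
    q ∣ a*a+b*b+c*c+d*d ∧ q ∣ a*e+b*f+c*g+d*h ∧ q ∣ e*e+f*f+g*g+h*h := by
  obtain ⟨P, hP⟩ := h1
  obtain ⟨Q, hQ⟩ := h2
  obtain ⟨R, hR⟩ := h3
  have k1 := hind (e*e+f*f+g*g+h*h) (-(a*e+b*f+c*g+d*h))
    ⟨-P*f - Q*g - R*h, by linear_combination (-f)*hP + (-g)*hQ + (-h)*hR⟩
    ⟨P*e + Q*h - R*g, by linear_combination e*hP + h*hQ + (-g)*hR⟩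
    ⟨-P*h + Q*e + R*f, by linear_combination (-h)*hP + e*hQ + f*hR⟩
    ⟨P*g - Q*f + R*e, by linear_combination g*hP + (-f)*hQ + e*hR⟩
  have k2 := hind (a*e+b*f+c*g+d*h) (-(a*a+b*b+c*c+d*d))
    ⟨-P*b - Q*c - R*d, by linear_combination (-b)*hP + (-c)*hQ + (-d)*hR⟩
    ⟨P*a + Q*d - R*c, by linear_combination a*hP + d*hQ + (-c)*hR⟩
    ⟨-P*d + Q*a + R*b, by linear_combination (-d)*hP + a*hQ + b*hR⟩
    ⟨P*c - Q*b + R*a, by linear_combination c*hP + (-b)*hQ + a*hR⟩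
  exact ⟨(dvd_neg.mp k2.2), k2.1, k1.1⟩

lemma aux_fwd2 (q a b c d e f g h : ℤ)
    (hind : ∀ x y : ℤ, q ∣ x*a + y*e → q ∣ x*b + y*f → q ∣ x*c + y*g → q ∣ x*d + y*h →
      q ∣ x ∧ q ∣ y)
    (h1 : q ∣ -a*f + b*e + c*h - d*g) (h2 : q ∣ -a*g - b*h + c*e + d*f)
    (h3 : q ∣ -a*h + b*g - c*f + d*e) :
    q ∣ a*a+b*b+c*c+d*d ∧ q ∣ a*e+b*f+c*g+d*h ∧ q ∣ e*e+f*f+g*g+h*h := by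
  obtain ⟨P, hP⟩ := h1
  obtain ⟨Q, hQ⟩ := h2
  obtain ⟨R, hR⟩ := h3
  have k1 := hind (e*e+f*f+g*g+h*h) (-(a*e+b*f+c*g+d*h))
    ⟨-P*f - Q*g - R*h, by linear_combination (-f)*hP + (-g)*hQ + (-h)*hR⟩
    ⟨P*e - Q*h + R*g, by linear_combination e*hP - h*hQ + (g)*hR⟩
    ⟨P*h + Q*e - R*f, by linear_combination (h)*hP + e*hQ - f*hR⟩
    ⟨-P*g + Q*f + R*e, by linear_combination -g*hP + (f)*hQ + e*hR⟩
  have k2 := hind (a*e+b*f+c*g+d*h) (-(a*a+b*b+c*c+d*d))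
    ⟨-P*b - Q*c - R*d, by linear_combination (-b)*hP + (-c)*hQ + (-d)*hR⟩
    ⟨P*a - Q*d + R*c, by linear_combination a*hP - d*hQ + (c)*hR⟩
    ⟨P*d + Q*a - R*b, by linear_combination (d)*hP + a*hQ - b*hR⟩
    ⟨-P*c + Q*b + R*a, by linear_combination -c*hP + (b)*hQ + a*hR⟩
  exact ⟨(dvd_neg.mp k2.2), k2.1, k1.1⟩

lemma aux_comb (q A B C X Y Z T : ℤ) (hq : IsCoprime q 2) (hA : q ∣ A) (hB : q ∣ B) (hC : q ∣ C)
    (h : 2 * T = -(C*X - 2*B*Y + A*Z)) : q ∣ T := by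
  refine hq.dvd_of_dvd_mul_left ?_
  rw [h, dvd_neg]
  exact dvd_add (dvd_sub (hC.mul_right _) ((hB.mul_left _).mul_right _)) (hA.mul_right _)

lemma aux_conv (q a b c d e f g h : ℤ) (hq : IsCoprime q 2)
    (hA : q ∣ a*a+b*b+c*c+d*d) (hB : q ∣ a*e+b*f+c*g+d*h) (hC : q ∣ e*e+f*f+g*g+h*h)
    (P Q R P' Q' R' : ℤ)
    (hP : P = -a*f + b*e - c*h + d*g) (hQ : Q = -a*g + b*h + c*e - d*f)
    (hR : R = -a*h - b*g + c*f + d*e)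
    (hP' : P' = -a*f + b*e + c*h - d*g) (hQ' : Q' = -a*g - b*h + c*e + d*f)
    (hR' : R' = -a*h + b*g - c*f + d*e) :
    (q ∣ P * P' ∧ q ∣ P * Q' ∧ q ∣ P * R') ∧ (q ∣ Q * P' ∧ q ∣ Q * Q' ∧ q ∣ Q * R') ∧
    (q ∣ R * P' ∧ q ∣ R * Q' ∧ q ∣ R * R') := by
  subst hP hQ hR hP' hQ' hR'
  refine ⟨⟨?_, ?_, ?_⟩, ⟨?_, ?_, ?_⟩, ⟨?_, ?_, ?_⟩⟩
  · exact aux_comb q _ _ _ (- a*a - b*b + c*c + d*d) (- a*e - b*f + c*g + d*h)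
      (- e*e - f*f + g*g + h*h) _ hq hA hB hC (by ring)
  · exact aux_comb q _ _ _ (d*a - c*b - b*c + a*d) (d*e - c*f - b*g + a*h)
      (h*e - g*f - f*g + e*h) _ hq hA hB hC (by ring)
  · exact aux_comb q _ _ _ (- c*a - d*b - a*c - b*d) (- c*e - d*f - a*g - b*h)
      (- g*e - h*f - e*g - f*h) _ hq hA hB hC (by ring)
  · exact aux_comb q _ _ _ (- d*a - c*b - b*c - a*d) (- d*e - c*f - b*g - a*h)
      (- h*e - g*f - f*g - e*h) _ hq hA hB hC (by ring)
  · exact aux_comb q _ _ _ (- a*a + b*b - c*c + d*d) (- a*e + b*f - c*g + d*h)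
      (- e*e + f*f - g*g + h*h) _ hq hA hB hC (by ring)
  · exact aux_comb q _ _ _ (b*a + a*b - d*c - c*d) (b*e + a*f - d*g - c*h)
      (f*e + e*f - h*g - g*h) _ hq hA hB hC (by ring)
  · exact aux_comb q _ _ _ (c*a - d*b + a*c - b*d) (c*e - d*f + a*g - b*h)
      (g*e - h*f + e*g - f*h) _ hq hA hB hC (by ring)
  · exact aux_comb q _ _ _ (- b*a - a*b - d*c - c*d) (- b*e - a*f - d*g - c*h)
      (- f*e - e*f - h*g - g*h) _ hq hA hB hC (by ring)
  · exact aux_comb q _ _ _ (- a*a + b*b + c*c - d*d) (- a*e + b*f + c*g - d*h)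
      (- e*e + f*f + g*g - h*h) _ hq hA hB hC (by ring)

/-- primitivity: not both points divisible by `p`. -/
lemma aux_prim_s16 (p : ℕ) [hp : Fact p.Prime] (a b c d e f g h : ℤ)
    (hind : ∀ x y : ℤ, (p:ℤ) ∣ x*a + y*e → (p:ℤ) ∣ x*b + y*f → (p:ℤ) ∣ x*c + y*g →
      (p:ℤ) ∣ x*d + y*h → (p:ℤ) ∣ x ∧ (p:ℤ) ∣ y)
    (hq : IsCoprime (p:ℤ) 2)
    (h1 : (p:ℤ) ∣ -a*f + b*e - c*h + d*g) (h2 : (p:ℤ) ∣ -a*g + b*h + c*e - d*f)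
    (h3 : (p:ℤ) ∣ -a*h - b*g + c*f + d*e)
    (h1' : (p:ℤ) ∣ -a*f + b*e + c*h - d*g) (h2' : (p:ℤ) ∣ -a*g - b*h + c*e + d*f)
    (h3' : (p:ℤ) ∣ -a*h + b*g - c*f + d*e) : False := by
  have key : ∀ X Y T : ℤ, (p:ℤ) ∣ X → (p:ℤ) ∣ Y → 2 * T = X + Y → (p:ℤ) ∣ T := by
    intro X Y T hX hY hT
    exact hq.dvd_of_dvd_mul_left (hT ▸ dvd_add hX hY)
  have ab : (p:ℤ) ∣ b*e - a*f := key _ _ _ h1 h1' (by ring)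
  have ac : (p:ℤ) ∣ c*e - a*g := key _ _ _ h2 h2' (by ring)
  have ad : (p:ℤ) ∣ d*e - a*h := key _ _ _ h3 h3' (by ring)
  have cd : (p:ℤ) ∣ d*g - c*h := key _ _ _ h1 (dvd_neg.mpr h1') (by ring)
  have bd : (p:ℤ) ∣ d*f - b*h := key _ _ _ (dvd_neg.mpr h2) h2' (by ring)
  have bc : (p:ℤ) ∣ c*f - b*g := key _ _ _ h3 (dvd_neg.mpr h3') (by ring)
  have nn : ∀ X Y : ℤ, (p:ℤ) ∣ X → Y = -X → (p:ℤ) ∣ Y := by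
    rintro X Y hX rfl; exact dvd_neg.mpr hX
  have ee : ∀ X Y : ℤ, (p:ℤ) ∣ X → Y = X → (p:ℤ) ∣ Y := by
    rintro X Y hX rfl; exact hX
  have zz : ∀ Y : ℤ, Y = 0 → (p:ℤ) ∣ Y := by rintro Y rfl; exact dvd_zero _
  have da := (hind e (-a) (zz _ (by ring)) (ee _ _ ab (by ring)) (ee _ _ ac (by ring))
    (ee _ _ ad (by ring))).2
  have db := (hind f (-b) (nn _ _ ab (by ring)) (zz _ (by ring)) (ee _ _ bc (by ring))
    (ee _ _ bd (by ring))).2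
  have dc := (hind g (-c) (nn _ _ ac (by ring)) (nn _ _ bc (by ring)) (zz _ (by ring))
    (ee _ _ cd (by ring))).2
  have dd := (hind h (-d) (nn _ _ ad (by ring)) (nn _ _ bd (by ring)) (nn _ _ cd (by ring))
    (zz _ (by ring))).2
  have := (hind 1 0 (nn _ _ da (by ring)) (nn _ _ db (by ring)) (nn _ _ dc (by ring))
    (nn _ _ dd (by ring))).1
  exact hp.out.one_lt.ne' (by exact_mod_cast Int.eq_one_of_dvd_one (by positivity) this)

lemma aux_key (p : ℕ) [hp : Fact p.Prime] (hp2 : p ≠ 2) (a b c d e f g h : ℤ)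
    (hind : ∀ q x y : ℤ, q ≠ 0 → q ∣ x*a + y*e → q ∣ x*b + y*f → q ∣ x*c + y*g → q ∣ x*d + y*h →
      q ∣ x ∧ q ∣ y) (m : ℕ) :
    ((p:ℤ)^m ∣ a*a+b*b+c*c+d*d ∧ (p:ℤ)^m ∣ a*e+b*f+c*g+d*h ∧ (p:ℤ)^m ∣ e*e+f*f+g*g+h*h) ↔
    (((p:ℤ)^m ∣ -a*f + b*e - c*h + d*g ∧ (p:ℤ)^m ∣ -a*g + b*h + c*e - d*f ∧
      (p:ℤ)^m ∣ -a*h - b*g + c*f + d*e) ∨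
     ((p:ℤ)^m ∣ -a*f + b*e + c*h - d*g ∧ (p:ℤ)^m ∣ -a*g - b*h + c*e + d*f ∧
      (p:ℤ)^m ∣ -a*h + b*g - c*f + d*e)) := by
  have hp0 : (p:ℤ) ≠ 0 := by exact_mod_cast hp.out.ne_zero
  have hpp : Prime (p:ℤ) := Nat.prime_iff_prime_int.mp hp.out
  have hc2 : IsCoprime (p:ℤ) 2 := by
    have := (Nat.coprime_primes hp.out Nat.prime_two).mpr hp2
    exact_mod_cast Nat.isCoprime_iff_coprime.mpr this
  constructor
  · rintro ⟨hA, hB, hC⟩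
    obtain ⟨⟨x1, x2, x3⟩, ⟨y1, y2, y3⟩, ⟨z1, z2, z3⟩⟩ :=
      aux_conv _ a b c d e f g h (hc2.pow_left) hA hB hC _ _ _ _ _ _ rfl rfl rfl rfl rfl rfl
    have cop : ∀ X : ℤ, ¬ (p:ℤ) ∣ X → IsCoprime ((p:ℤ)^m) X := fun X hX =>
      ((hpp.coprime_iff_not_dvd).mpr hX).pow_left
    by_cases k1 : (p:ℤ) ∣ -a*f + b*e - c*h + d*g
    · by_cases k2 : (p:ℤ) ∣ -a*g + b*h + c*e - d*f
      · by_cases k3 : (p:ℤ) ∣ -a*h - b*g + c*f + d*e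
        · left
          by_cases l1 : (p:ℤ) ∣ -a*f + b*e + c*h - d*g
          · by_cases l2 : (p:ℤ) ∣ -a*g - b*h + c*e + d*f
            · by_cases l3 : (p:ℤ) ∣ -a*h + b*g - c*f + d*e
              · exact (aux_prim_s16 p a b c d e f g h (fun x y => hind p x y hp0) hc2
                  k1 k2 k3 l1 l2 l3).elim
              · have := cop _ l3
                exact ⟨this.dvd_of_dvd_mul_right x3, this.dvd_of_dvd_mul_right y3,
                  this.dvd_of_dvd_mul_right z3⟩
            · have := cop _ l2
              exact ⟨this.dvd_of_dvd_mul_right x2, this.dvd_of_dvd_mul_right y2,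
                this.dvd_of_dvd_mul_right z2⟩
          · have := cop _ l1
            exact ⟨this.dvd_of_dvd_mul_right x1, this.dvd_of_dvd_mul_right y1,
              this.dvd_of_dvd_mul_right z1⟩
        · right
          have := cop _ k3
          exact ⟨this.dvd_of_dvd_mul_left z1, this.dvd_of_dvd_mul_left z2,
            this.dvd_of_dvd_mul_left z3⟩
      · right
        have := cop _ k2
        exact ⟨this.dvd_of_dvd_mul_left y1, this.dvd_of_dvd_mul_left y2,
          this.dvd_of_dvd_mul_left y3⟩
    · right
      have := cop _ k1
      exact ⟨this.dvd_of_dvd_mul_left x1, this.dvd_of_dvd_mul_left x2,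
        this.dvd_of_dvd_mul_left x3⟩
  · rintro (⟨h1, h2, h3⟩ | ⟨h1, h2, h3⟩)
    · exact aux_fwd1 _ a b c d e f g h (fun x y => hind _ x y (pow_ne_zero _ hp0)) h1 h2 h3
    · exact aux_fwd2 _ a b c d e f g h (fun x y => hind _ x y (pow_ne_zero _ hp0)) h1 h2 h3

lemma aux_group {G H : Type*} [AddCommGroup G] [AddCommGroup H] (p : ℕ) [hp : Fact p.Prime]
    (φ : G →+ H) (hsurj : Function.Surjective φ) (n : ℕ) (hH : ∀ y : H, ((p:ℤ)^n) • y = 0)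
    (D E : ℤ) (hD : ¬ (p:ℤ) ∣ D) (hE : ¬ (p:ℤ) ∣ E)
    (hG : ∀ x : G, ((p:ℤ)^n * D) • x = 0) (hker : ∀ x : G, φ x = 0 → E • x = 0) :
    Nonempty (AddCommGroup.primaryComponent G p ≃+ H) := by
  have hpp : Prime (p:ℤ) := Nat.prime_iff_prime_int.mp hp.out
  refine ⟨AddEquiv.ofBijective (φ.comp (AddCommGroup.primaryComponent G p).subtype) ⟨?_, ?_⟩⟩
  · rw [injective_iff_map_eq_zero]
    rintro ⟨x, hx⟩ h0
    obtain ⟨N, hN⟩ := AddCommGroup.mem_primaryComponent.mp hx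
    have h1 : E • x = 0 := hker x h0
    obtain ⟨s, t, hst⟩ := (((hpp.coprime_iff_not_dvd).mpr hE).pow_left : IsCoprime ((p:ℤ)^N) E)
    have h2 : ((p:ℤ)^N) • x = 0 := by
      rw [← hN]; exact_mod_cast natCast_zsmul x (p^N)
    apply Subtype.ext
    change x = 0
    rw [← one_zsmul x, ← hst, add_zsmul, mul_zsmul, mul_zsmul, h1, h2]
    simp
  · intro y
    obtain ⟨x, rfl⟩ := hsurj y
    obtain ⟨s, t, hst⟩ := (((hpp.coprime_iff_not_dvd).mpr hD).pow_left : IsCoprime ((p:ℤ)^n) D)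
    refine ⟨⟨(t * D) • x, AddCommGroup.mem_primaryComponent.mpr ⟨n, ?_⟩⟩, ?_⟩
    · have : ((p:ℤ)^n) • ((t*D) • x) = 0 := by
        rw [← mul_zsmul, show (p:ℤ)^n * (t * D) = t * ((p:ℤ)^n * D) by ring, mul_zsmul, hG]
        simp
      rw [← this]
      have h3 := natCast_zsmul ((t*D) • x) (p^n)
      rw [← h3]; push_cast; rfl
    · change φ ((t*D) • x) = φ x
      have : φ x = (s * (p:ℤ)^n + t * D) • φ x := by rw [hst, one_zsmul]
      rw [this, add_zsmul, mul_zsmul _ s, hH, map_zsmul]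
      simp


lemma aux_rep {L : Submodule ℚ ℍ[ℚ]} {v₁ v₂ : ℍ[ℚ]} (hb : IsZBasisQuat L v₁ v₂) (x : ℍ[ℚ])
    (hx : x ∈ L) : ∃ α β : ℚ, x = α • v₁ + β • v₂ := by
  obtain ⟨-, -, -, -, -, h⟩ := hb
  have hN : ((x.re.den * x.imI.den * x.imJ.den * x.imK.den : ℕ) : ℚ) ≠ 0 := by
    have h1 := x.re.den_nz
    have h2 := x.imI.den_nz
    have h3 := x.imJ.den_nz
    have h4 := x.imK.den_nz
    exact_mod_cast mul_ne_zero (mul_ne_zero (mul_ne_zero h1 h2) h3) h4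
  set N : ℚ := ((x.re.den * x.imI.den * x.imJ.den * x.imK.den : ℕ) : ℚ) with hNdef
  obtain ⟨m, n, hmn⟩ := h (N • x) (L.smul_mem _ hx) (by
    have h1 := Rat.den_mul_eq_num x.re
    have h2 := Rat.den_mul_eq_num x.imI
    have h3 := Rat.den_mul_eq_num x.imJ
    have h4 := Rat.den_mul_eq_num x.imK
    refine ⟨x.re.num * x.imI.den * x.imJ.den * x.imK.den,
      x.re.den * x.imI.num * x.imJ.den * x.imK.den,
      x.re.den * x.imI.den * x.imJ.num * x.imK.den,
      x.re.den * x.imI.den * x.imJ.den * x.imK.num, ?_, ?_, ?_, ?_⟩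
    · simp only [Quaternion.re_smul, smul_eq_mul, hNdef]; push_cast; rw [← h1]; ring
    · simp only [Quaternion.imI_smul, smul_eq_mul, hNdef]; push_cast; rw [← h2]; ring
    · simp only [Quaternion.imJ_smul, smul_eq_mul, hNdef]; push_cast; rw [← h3]; ring
    · simp only [Quaternion.imK_smul, smul_eq_mul, hNdef]; push_cast; rw [← h4]; ring)
  refine ⟨N⁻¹ * m, N⁻¹ * n, ?_⟩
  rw [mul_smul, mul_smul, ← smul_add, ← hmn, smul_smul, inv_mul_cancel₀ hN, one_smul]

/-- pairing with a lattice vector, as an integer-valued hom. -/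
noncomputable def auxPair (L : Submodule ℚ ℍ[ℚ]) (w : ℍ[ℚ]) (hw : w ∈ latticeIn L) :
    dualLatticeIn L →+ ℤ where
  toFun x := ⌊((x : ℍ[ℚ]) * star w).re⌋
  map_zero' := by simp
  map_add' x y := by
    obtain ⟨m, hm⟩ := x.2.2 w hw
    obtain ⟨n, hn⟩ := y.2.2 w hw
    have : (((x + y : dualLatticeIn L) : ℍ[ℚ]) * star w).re = ((m + n : ℤ) : ℚ) := by
      rw [AddSubgroup.coe_add, add_mul, Quaternion.re_add, hm, hn]; push_cast; rfl
    rw [this, hm, hn, Int.floor_intCast, Int.floor_intCast, Int.floor_intCast]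

lemma auxPair_spec (L : Submodule ℚ ℍ[ℚ]) (w : ℍ[ℚ]) (hw : w ∈ latticeIn L)
    (x : dualLatticeIn L) : ((x : ℍ[ℚ]) * star w).re = (auxPair L w hw x : ℚ) := by
  obtain ⟨m, hm⟩ := x.2.2 w hw
  change _ = ((⌊((x : ℍ[ℚ]) * star w).re⌋ : ℤ) : ℚ)
  rw [hm, Int.floor_intCast]

lemma aux_symm (x y : ℍ[ℚ]) : (x * star y).re = (y * star x).re := by
  simp only [Quaternion.re_mul, Quaternion.re_star, Quaternion.imI_star, Quaternion.imJ_star,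
    Quaternion.imK_star]
  ring

lemma aux_lin (α β : ℚ) (x y z : ℍ[ℚ]) :
    ((α • x + β • y) * star z).re = α * (x * star z).re + β * (y * star z).re := by
  rw [add_mul, smul_mul_assoc, smul_mul_assoc]
  simp only [Quaternion.re_add, Quaternion.re_smul, smul_eq_mul]

lemma aux_core (p : ℕ) [hp : Fact p.Prime] (L : Submodule ℚ ℍ[ℚ]) (v₁ v₂ : ℍ[ℚ])
    (hb : IsZBasisQuat L v₁ v₂) (u b c D : ℤ) (k r : ℕ)
    (hA : (v₁ * star v₁).re = (((p:ℤ)^k * u : ℤ) : ℚ))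
    (hB : (v₁ * star v₂).re = (((p:ℤ)^k * b : ℤ) : ℚ))
    (hC : (v₂ * star v₂).re = (((p:ℤ)^k * c : ℤ) : ℚ))
    (hu : ¬ (p:ℤ) ∣ u) (hD : ¬ (p:ℤ) ∣ D) (hdet : u * c - b^2 = (p:ℤ)^r * D) :
    Nonempty ((AddCommGroup.primaryComponent (glueGroup L) p) ≃+
      (ZMod (p ^ k) × ZMod (p ^ (k + r)))) := by
  have hpp : Prime (p:ℤ) := Nat.prime_iff_prime_int.mp hp.out
  have hp0 : (p:ℤ) ≠ 0 := hpp.ne_zero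
  have hp0q : (p:ℚ) ≠ 0 := by exact_mod_cast hp0
  have hD0 : D ≠ 0 := by rintro rfl; simp at hD
  have hD0q : (D:ℚ) ≠ 0 := by exact_mod_cast hD0
  have hdetq : (u:ℚ) * c - b^2 = (p:ℚ)^r * D := by exact_mod_cast hdet
  have m1 : v₁ ∈ latticeIn L := ⟨hb.1, hb.2.2.1⟩
  have m2 : v₂ ∈ latticeIn L := ⟨hb.2.1, hb.2.2.2.1⟩
  have hB' := hB
  rw [aux_symm] at hB'
  push_cast at hA hB hC hB'
  set s := auxPair L v₁ m1 with hs
  set t := auxPair L v₂ m2 with ht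
  -- lattice membership
  have hlat : ∀ m n : ℤ, (m:ℚ) • v₁ + (n:ℚ) • v₂ ∈ latticeIn L := by
    intro m n
    have := (latticeIn L).add_mem ((latticeIn L).zsmul_mem m1 m) ((latticeIn L).zsmul_mem m2 n)
    rwa [← Int.cast_smul_eq_zsmul ℚ, ← Int.cast_smul_eq_zsmul ℚ] at this
  -- Cramer
  have hcr : ∀ x : dualLatticeIn L, ((p:ℚ)^(k+r) * D) • (x : ℍ[ℚ]) =
      ((c * s x - b * t x : ℤ) : ℚ) • v₁ + ((u * t x - b * s x : ℤ) : ℚ) • v₂ := by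
    intro x
    obtain ⟨α, β, hx⟩ := aux_rep hb x x.2.1
    have e1 := auxPair_spec L v₁ m1 x
    have e2 := auxPair_spec L v₂ m2 x
    rw [hx, aux_lin, hA, hB'] at e1
    rw [hx, aux_lin, hB, hC] at e2
    rw [hx, smul_add, smul_smul, smul_smul]
    push_cast
    rw [← hs] at e1
    rw [← ht] at e2
    rw [← e1, ← e2]
    congr 2
    · rw [pow_add]; linear_combination (-(p:ℚ)^k * α) * hdetq
    · rw [pow_add]; linear_combination (-(p:ℚ)^k * β) * hdetq
  have hex : ∀ S T : ℤ, ∃ x : dualLatticeIn L, s x = S ∧ t x = T := by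
    intro S T
    let y : ℍ[ℚ] := (((p:ℚ)^(k+r) * D)⁻¹ * (c * S - b * T)) • v₁ +
      (((p:ℚ)^(k+r) * D)⁻¹ * (u * T - b * S)) • v₂
    have y1 : (y * star v₁).re = S := by
      simp only [y]
      rw [aux_lin, hA, hB', pow_add, mul_assoc ((p:ℚ)^k), ← hdetq]
      have : (u:ℚ) * c - b^2 ≠ 0 := by rw [hdetq]; positivity
      field_simp
      ring
    have y2 : (y * star v₂).re = T := by
      simp only [y]
      rw [aux_lin, hB, hC, pow_add, mul_assoc ((p:ℚ)^k), ← hdetq]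
      have : (u:ℚ) * c - b^2 ≠ 0 := by rw [hdetq]; positivity
      field_simp
      ring
    have yL : y ∈ L := L.add_mem (L.smul_mem _ hb.1) (L.smul_mem _ hb.2.1)
    have yd : y ∈ dualLatticeIn L := by
      refine ⟨yL, fun w hw => ?_⟩
      obtain ⟨m, n, rfl⟩ := hb.2.2.2.2.2 w hw.1 hw.2
      refine ⟨m * S + n * T, ?_⟩
      rw [aux_symm, aux_lin, aux_symm v₁, aux_symm v₂, y1, y2]
      push_cast; rfl
    refine ⟨⟨y, yd⟩, ?_, ?_⟩
    · have := auxPair_spec L v₁ m1 ⟨y, yd⟩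
      rw [y1] at this
      exact_mod_cast this.symm
    · have := auxPair_spec L v₂ m2 ⟨y, yd⟩
      rw [y2] at this
      exact_mod_cast this.symm
  let φ₀ : dualLatticeIn L →+ ZMod (p ^ k) × ZMod (p ^ (k + r)) :=
    AddMonoidHom.prod ((Int.castAddHom _).comp s) ((Int.castAddHom _).comp (u • t - b • s))
  have hφ₀ : ∀ x, φ₀ x = ((s x : ZMod (p^k)), ((u * t x - b * s x : ℤ) : ZMod (p^(k+r)))) := by
    intro x; simp [φ₀]
  have hφ0 : ∀ x, φ₀ x = 0 ↔ (p:ℤ)^k ∣ s x ∧ (p:ℤ)^(k+r) ∣ u * t x - b * s x := by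
    intro x
    rw [hφ₀, Prod.mk_eq_zero, ZMod.intCast_zmod_eq_zero_iff_dvd, ZMod.intCast_zmod_eq_zero_iff_dvd]
    push_cast
    rfl
  have hle : (latticeIn L).addSubgroupOf (dualLatticeIn L) ≤ φ₀.ker := by
    intro x hx
    rw [AddSubgroup.mem_addSubgroupOf] at hx
    rw [AddMonoidHom.mem_ker, hφ0]
    obtain ⟨m, n, hmn⟩ := hb.2.2.2.2.2 x hx.1 hx.2
    have e1 := auxPair_spec L v₁ m1 x
    have e2 := auxPair_spec L v₂ m2 x
    rw [hmn, aux_lin, hA, hB'] at e1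
    rw [hmn, aux_lin, hB, hC] at e2
    have e1' : m * (p^k * u) + n * (p^k * b) = s x := by exact_mod_cast e1
    have e2' : m * (p^k * b) + n * (p^k * c) = t x := by exact_mod_cast e2
    refine ⟨⟨m * u + n * b, by rw [← e1']; ring⟩, ⟨n * D, ?_⟩⟩
    rw [← e1', ← e2', pow_add]
    linear_combination (n * (p:ℤ)^k) * hdet
  let φ : glueGroup L →+ ZMod (p ^ k) × ZMod (p ^ (k + r)) :=
    QuotientAddGroup.lift _ φ₀ hle
  have hφ : ∀ x : dualLatticeIn L, φ (QuotientAddGroup.mk x : dualLatticeIn L ⧸ _) = φ₀ x :=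
    fun x => rfl
  have hz : ∀ (z : ℤ) (x : dualLatticeIn L), (z:ℚ) • (x : ℍ[ℚ]) ∈ latticeIn L →
      z • (show glueGroup L from (QuotientAddGroup.mk x : dualLatticeIn L ⧸ _)) = 0 := by
    intro z x h
    refine (QuotientAddGroup.eq_zero_iff (z • x)).mpr ?_
    rw [AddSubgroup.mem_addSubgroupOf, AddSubgroup.coe_zsmul]
    rwa [Int.cast_smul_eq_zsmul ℚ] at h
  refine aux_group p φ ?_ (k + r) ?_ D (D * u) hD ?_ ?_ ?_
  · rintro ⟨y1, y2⟩
    obtain ⟨S, rfl⟩ := ZMod.intCast_surjective y1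
    obtain ⟨Y, rfl⟩ := ZMod.intCast_surjective y2
    obtain ⟨i, j, hij⟩ :=
      (((hpp.coprime_iff_not_dvd).mpr hu).pow_left : IsCoprime ((p:ℤ)^(k+r)) u)
    obtain ⟨x, hx1, hx2⟩ := hex S (j * (Y + b * S))
    refine ⟨(QuotientAddGroup.mk x : dualLatticeIn L ⧸ _), ?_⟩
    rw [hφ, hφ₀, hx1, hx2]
    refine Prod.ext rfl ?_
    change ((_ : ℤ) : ZMod (p^(k+r))) = ((Y : ℤ) : ZMod (p^(k+r)))
    rw [ZMod.intCast_eq_intCast_iff_dvd_sub]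
    refine ⟨i * (Y + b * S), ?_⟩
    push_cast
    linear_combination (-(Y + b * S)) * hij
  · rintro ⟨y1, y2⟩
    obtain ⟨S, rfl⟩ := ZMod.intCast_surjective y1
    obtain ⟨Y, rfl⟩ := ZMod.intCast_surjective y2
    rw [Prod.smul_mk, Prod.mk_eq_zero, zsmul_eq_mul, zsmul_eq_mul, ← Int.cast_mul, ← Int.cast_mul,
      ZMod.intCast_zmod_eq_zero_iff_dvd, ZMod.intCast_zmod_eq_zero_iff_dvd]
    push_cast
    exact ⟨(pow_dvd_pow _ (Nat.le_add_right _ _)).mul_right _, dvd_mul_right _ _⟩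
  · intro h
    rcases hpp.dvd_or_dvd h with h | h
    · exact hD h
    · exact hu h
  · intro x
    obtain ⟨x, rfl⟩ := QuotientAddGroup.mk_surjective x
    apply hz
    push_cast
    rw [hcr]
    exact hlat _ _
  · intro x h0
    obtain ⟨x, rfl⟩ := QuotientAddGroup.mk_surjective x
    obtain ⟨⟨i, hi⟩, ⟨j, hj⟩⟩ := (hφ0 x).mp h0
    apply hz
    have h1 := hcr x
    have h2 : ((D * u : ℤ) : ℚ) • (x : ℍ[ℚ]) =
        ((D * i - b * j : ℤ) : ℚ) • v₁ + ((u * j : ℤ) : ℚ) • v₂ := by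
      have hq : (p:ℚ)^(k+r) ≠ 0 := pow_ne_zero _ hp0q
      apply smul_right_injective _ hq
      change (p:ℚ)^(k+r) • _ = (p:ℚ)^(k+r) • _
      have h3 : (p:ℚ)^(k+r) • ((D * u : ℤ) : ℚ) • (x : ℍ[ℚ]) =
          (u:ℚ) • ((p:ℚ)^(k+r) * D) • (x : ℍ[ℚ]) := by
        rw [smul_smul, smul_smul]; congr 1; push_cast; ring
      rw [h3, h1, smul_add, smul_add, smul_smul, smul_smul, smul_smul, smul_smul]
      have c1 : u * (c * s x - b * t x) = (p:ℤ)^(k+r) * (D * i - b * j) := by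
        rw [pow_add] at hj ⊢
        linear_combination (s x) * hdet - b * hj + (p:ℤ)^r * D * hi
      have c2 : u * (u * t x - b * s x) = (p:ℤ)^(k+r) * (u * j) := by
        rw [hj]; ring
      congr 2
      · exact_mod_cast c1
      · exact_mod_cast c2
    rw [h2]
    exact hlat _ _

lemma aux_core2 (p : ℕ) [hp : Fact p.Prime] (hp2 : p ≠ 2) (L : Submodule ℚ ℍ[ℚ]) (v₁ v₂ : ℍ[ℚ])
    (hb : IsZBasisQuat L v₁ v₂) (u b c D : ℤ) (k r : ℕ)
    (hA : (v₁ * star v₁).re = (((p:ℤ)^k * u : ℤ) : ℚ))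
    (hB : (v₁ * star v₂).re = (((p:ℤ)^k * b : ℤ) : ℚ))
    (hC : (v₂ * star v₂).re = (((p:ℤ)^k * c : ℤ) : ℚ))
    (hu : ¬ ((p:ℤ) ∣ u ∧ (p:ℤ) ∣ b ∧ (p:ℤ) ∣ c)) (hD : ¬ (p:ℤ) ∣ D)
    (hdet : u * c - b^2 = (p:ℤ)^r * D) :
    Nonempty ((AddCommGroup.primaryComponent (glueGroup L) p) ≃+
      (ZMod (p ^ k) × ZMod (p ^ (k + r)))) := by
  obtain ⟨h1, h2, h3, h4, h5, h6⟩ := id hb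
  rw [LinearIndependent.pair_iff] at h5
  have hB' := hB
  rw [aux_symm] at hB'
  by_cases ku : (p:ℤ) ∣ u
  · by_cases kc : (p:ℤ) ∣ c
    · have kb : ¬ (p:ℤ) ∣ b := fun kb => hu ⟨ku, kb, kc⟩
      have hpp : Prime (p:ℤ) := Nat.prime_iff_prime_int.mp hp.out
      have hc2 : IsCoprime (p:ℤ) 2 := by
        have := (Nat.coprime_primes hp.out Nat.prime_two).mpr hp2
        exact_mod_cast Nat.isCoprime_iff_coprime.mpr this
      refine aux_core p L (v₁ + v₂) v₂ ⟨L.add_mem h1 h2, h2, h3.add h4, h4, ?_, ?_⟩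
        (u + 2 * b + c) (b + c) c D k r ?_ ?_ hC ?_ hD (by rw [← hdet]; ring)
      · rw [LinearIndependent.pair_iff]
        intro x y hxy
        have := h5 x (x + y) (by rw [← hxy, smul_add, add_smul]; abel)
        exact ⟨this.1, by linarith [this.1, this.2]⟩
      · intro x hx hxi
        obtain ⟨m, n, hmn⟩ := h6 x hx hxi
        refine ⟨m, n - m, ?_⟩
        rw [hmn]; push_cast; rw [smul_add, sub_smul]; abel
      · rw [star_add, add_mul, mul_add, mul_add]
        simp only [Quaternion.re_add]
        rw [hA, hB, hB', hC]; push_cast; ring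
      · rw [add_mul]
        simp only [Quaternion.re_add]
        rw [hB, hC]; push_cast; ring
      · intro h
        have : (p:ℤ) ∣ 2 * b := by
          have := dvd_sub (dvd_sub h ku) kc
          rwa [show u + 2 * b + c - u - c = 2 * b by ring] at this
        exact kb (hc2.dvd_of_dvd_mul_left this)
    · refine aux_core p L v₂ v₁ ⟨h2, h1, h4, h3, ?_, ?_⟩ c b u D k r hC hB' hA kc hD
        (by rw [← hdet]; ring)
      · rw [LinearIndependent.pair_iff]
        intro x y hxy
        have := h5 y x (by rw [← hxy]; abel)
        exact ⟨this.2, this.1⟩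
      · intro x hx hxi
        obtain ⟨m, n, hmn⟩ := h6 x hx hxi
        exact ⟨n, m, by rw [hmn]; abel⟩
  · exact aux_core p L v₁ v₂ hb u b c D k r hA hB hC ku hD hdet

lemma aux_vp (p m : ℕ) (x : ℍ[ℚ]) (P Q R : ℤ) (h0 : x.re = 0) (h1 : x.imI = P) (h2 : x.imJ = Q)
    (h3 : x.imK = R) :
    (m : ℕ∞) ≤ vpQuat p x ↔ (p:ℤ)^m ∣ P ∧ (p:ℤ)^m ∣ Q ∧ (p:ℤ)^m ∣ R := by
  unfold vpQuat
  rw [h0, h1, h2, h3]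
  simp only [le_min_iff, Rat.num_intCast, ← pow_dvd_iff_le_emultiplicity, Rat.num_zero, dvd_zero,
    true_and]

lemma aux_ind {L : Submodule ℚ ℍ[ℚ]} {v₁ v₂ : ℍ[ℚ]} (hb : IsZBasisQuat L v₁ v₂)
    (a b c d e f g h : ℤ) (ha : v₁.re = a) (hb1 : v₁.imI = b) (hc : v₁.imJ = c) (hd : v₁.imK = d)
    (he : v₂.re = e) (hf : v₂.imI = f) (hg : v₂.imJ = g) (hh : v₂.imK = h)
    (q x y : ℤ) (hq : q ≠ 0) (k1 : q ∣ x*a + y*e) (k2 : q ∣ x*b + y*f) (k3 : q ∣ x*c + y*g)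
    (k4 : q ∣ x*d + y*h) : q ∣ x ∧ q ∣ y := by
  obtain ⟨h1, h2, -, -, h5, h6⟩ := hb
  rw [LinearIndependent.pair_iff] at h5
  have hq' : (q:ℚ) ≠ 0 := by exact_mod_cast hq
  obtain ⟨z1, k1⟩ := k1
  obtain ⟨z2, k2⟩ := k2
  obtain ⟨z3, k3⟩ := k3
  obtain ⟨z4, k4⟩ := k4
  have k1' : (x:ℚ) * a + y * e = q * z1 := by exact_mod_cast k1
  have k2' : (x:ℚ) * b + y * f = q * z2 := by exact_mod_cast k2
  have k3' : (x:ℚ) * c + y * g = q * z3 := by exact_mod_cast k3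
  have k4' : (x:ℚ) * d + y * h = q * z4 := by exact_mod_cast k4
  obtain ⟨m, n, hmn⟩ := h6 ((q:ℚ)⁻¹ • ((x:ℚ) • v₁ + (y:ℚ) • v₂))
    (L.smul_mem _ (L.add_mem (L.smul_mem _ h1) (L.smul_mem _ h2)))
    ⟨z1, z2, z3, z4, by simp [ha, he]; rw [← mul_add, k1', inv_mul_cancel_left₀ hq'], by simp [hb1, hf]; rw [← mul_add, k2', inv_mul_cancel_left₀ hq'],
      by simp [hc, hg]; rw [← mul_add, k3', inv_mul_cancel_left₀ hq'], by simp [hd, hh]; rw [← mul_add, k4', inv_mul_cancel_left₀ hq']⟩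
  rw [inv_smul_eq_iff₀ hq'] at hmn
  have := h5 (x - q * m) (y - q * n) (by
    rw [sub_smul, sub_smul, sub_add_sub_comm, hmn, smul_add, smul_smul, smul_smul, sub_self])
  refine ⟨⟨m, ?_⟩, ⟨n, ?_⟩⟩
  · have := sub_eq_zero.mp this.1
    exact_mod_cast this
  · have := sub_eq_zero.mp this.2
    exact_mod_cast this


/-- Let `p` be an odd prime, `L` a 2-dimensional `ℚ`-subspace of
`ℍ(ℚ) ≅ ℚ⁴` with lattice `Λ = L ∩ ℤ⁴`, discriminant `D`, `ℤ`-basis `(v₁, v₂)` and associated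
points `a₁, a₂`.  With `k = max (v_p a₁) (v_p a₂)` and `n = v_p D`, the `p`-primary part of
the glue group `𝒢(Λ) = Λ*/Λ` is isomorphic to `(ℤ/p^k ℤ) × (ℤ/p^(n-k) ℤ)`. -/
theorem stmt_16 (p : ℕ) [hp : Fact p.Prime] (hp2 : p ≠ 2)
    (L : Submodule ℚ ℍ[ℚ]) (hdim : Module.finrank ℚ L = 2) (v₁ v₂ : ℍ[ℚ])
    (hbasis : IsZBasisQuat L v₁ v₂)
    (D : ℕ)
    (hdisc : Quaternion.normSq v₁ * Quaternion.normSq v₂ - (v₁ * star v₂).re ^ 2 = (D : ℚ))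
    (k n : ℕ)
    (hk : (k : ℕ∞) = max (vpQuat p ((v₁ * star v₂).im)) (vpQuat p ((star v₂ * v₁).im)))
    (hn : (n : ℕ∞) = emultiplicity p D) :
    Nonempty ((AddCommGroup.primaryComponent (glueGroup L) p) ≃+
      (ZMod (p ^ k) × ZMod (p ^ (n - k)))) := by
  obtain ⟨a, b, c, d, ha, hb, hc, hd⟩ := hbasis.2.2.1
  obtain ⟨e, f, g, h, he, hf, hg, hh⟩ := hbasis.2.2.2.1
  have hpp : Prime (p:ℤ) := Nat.prime_iff_prime_int.mp hp.out
  have hp0 : (p:ℤ) ≠ 0 := hpp.ne_zero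
  have key := aux_key p hp2 a b c d e f g h
    (aux_ind hbasis a b c d e f g h ha hb hc hd he hf hg hh)
  have hkm : ∀ m : ℕ, m ≤ k ↔ ((p:ℤ)^m ∣ a*a+b*b+c*c+d*d ∧ (p:ℤ)^m ∣ a*e+b*f+c*g+d*h ∧
      (p:ℤ)^m ∣ e*e+f*f+g*g+h*h) := by
    intro m
    rw [key m, ← Nat.cast_le (α := ℕ∞), hk, le_max_iff]
    refine or_congr (aux_vp p m _ _ _ _ ?_ ?_ ?_ ?_) (aux_vp p m _ _ _ _ ?_ ?_ ?_ ?_) <;>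
    · simp [ha, hb, hc, hd, he, hf, hg, hh]
      try ring
  obtain ⟨⟨u, hu⟩, ⟨β, hβ⟩, ⟨γ, hγ⟩⟩ := (hkm k).mp le_rfl
  have hk1 := mt (hkm (k+1)).mpr (by omega)
  have eA : (v₁ * star v₁).re = (((p:ℤ)^k * u : ℤ) : ℚ) := by
    rw [← hu]; simp [ha, hb, hc, hd]
  have eB : (v₁ * star v₂).re = (((p:ℤ)^k * β : ℤ) : ℚ) := by
    rw [← hβ]; simp [ha, hb, hc, hd, he, hf, hg, hh]
  have eC : (v₂ * star v₂).re = (((p:ℤ)^k * γ : ℤ) : ℚ) := by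
    rw [← hγ]; simp [he, hf, hg, hh]
  have hDz : ((p:ℤ)^k * u) * ((p:ℤ)^k * γ) - ((p:ℤ)^k * β)^2 = (D:ℤ) := by
    rw [Quaternion.normSq_def, Quaternion.normSq_def, eA, eB, eC] at hdisc
    exact_mod_cast hdisc
  obtain ⟨hn1, hn2⟩ := emultiplicity_eq_coe.mp hn.symm
  have h2k : 2 * k ≤ n := by
    by_contra hlt
    apply hn2
    have : (p:ℤ)^(2*k) ∣ (D:ℤ) := ⟨u * γ - β^2, by rw [← hDz]; ring⟩
    have : p^(2*k) ∣ D := by exact_mod_cast this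
    exact (pow_dvd_pow p (by omega)).trans this
  obtain ⟨r, rfl⟩ := Nat.exists_eq_add_of_le h2k
  obtain ⟨D', hD'⟩ := hn1
  rw [show 2 * k + r - k = k + r by omega]
  refine aux_core2 p hp2 L v₁ v₂ hbasis u β γ D' k r eA eB eC ?_ ?_ ?_
  · rintro ⟨q1, q2, q3⟩
    apply hk1
    rw [hu, hβ, hγ, pow_succ]
    exact ⟨mul_dvd_mul_left _ q1, mul_dvd_mul_left _ q2, mul_dvd_mul_left _ q3⟩
  · intro hq
    apply hn2
    rw [hD', pow_succ]
    exact mul_dvd_mul_left _ (by exact_mod_cast hq)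
  · apply mul_left_cancel₀ (pow_ne_zero (2*k) hp0)
    rw [hD'] at hDz
    push_cast at hDz
    rw [pow_add] at hDz
    linear_combination hDz
end

section
/- Let p be an odd prime and α ∈ 𝔽_p. Then the number of tuples (w₁,w₂,w₃,w₄,w₅,w₆) ∈ 𝔽_p⁶ satisfying w₁² + w₂² + w₃² + w₄² + w₅² + w₆² = α and w₁w₆ − w₂w₅ + w₃w₄ = 0 equals r_p(α)². -/
/-- `r_p(α)`: the number of triples `(x₁,x₂,x₃) ∈ 𝔽_p³` with `x₁² + x₂² + x₃² = α`. -/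
noncomputable def rp (p : ℕ) (α : ZMod p) : ℕ :=
  Nat.card {x : ZMod p × ZMod p × ZMod p // x.1 ^ 2 + x.2.1 ^ 2 + x.2.2 ^ 2 = α}

/-- For an odd prime `p` and `α ∈ 𝔽_p`, the number of sextuples
`(w₁,…,w₆) ∈ 𝔽_p⁶` with `w₁² + ⋯ + w₆² = α` and `w₁w₆ - w₂w₅ + w₃w₄ = 0` equals `r_p(α)²`. -/
theorem stmt_19 (p : ℕ) (hp : p.Prime) (hp2 : p ≠ 2) (α : ZMod p) :
    Nat.card {w : Fin 6 → ZMod p //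
        w 0 ^ 2 + w 1 ^ 2 + w 2 ^ 2 + w 3 ^ 2 + w 4 ^ 2 + w 5 ^ 2 = α ∧
          w 0 * w 5 - w 1 * w 4 + w 2 * w 3 = 0} = rp p α ^ 2 := by
  haveI : Fact p.Prime := ⟨hp⟩
  have h2 : (2 : ZMod p) ≠ 0 := by
    intro h
    have h' : ((2 : ℕ) : ZMod p) = 0 := by exact_mod_cast h
    rw [ZMod.natCast_eq_zero_iff] at h'
    exact hp2 ((Nat.prime_dvd_prime_iff_eq hp Nat.prime_two).1 h')
  unfold rp
  rw [sq, ← Nat.card_prod]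
  apply Nat.card_congr
  refine
    { toFun := fun w =>
        (⟨(w.1 0 + w.1 5, w.1 1 - w.1 4, w.1 2 + w.1 3), ?_⟩,
         ⟨(w.1 0 - w.1 5, w.1 1 + w.1 4, w.1 2 - w.1 3), ?_⟩)
      invFun := fun z =>
        ⟨![(z.1.1.1 + z.2.1.1) / 2, (z.1.1.2.1 + z.2.1.2.1) / 2, (z.1.1.2.2 + z.2.1.2.2) / 2,
           (z.1.1.2.2 - z.2.1.2.2) / 2, (z.2.1.2.1 - z.1.1.2.1) / 2,
           (z.1.1.1 - z.2.1.1) / 2], ?_, ?_⟩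
      left_inv := ?_
      right_inv := ?_ }
  · obtain ⟨w, h, h'⟩ := w
    simp only
    linear_combination h + 2 * h'
  · obtain ⟨w, h, h'⟩ := w
    simp only
    linear_combination h - 2 * h'
  · obtain ⟨⟨⟨a, b, c⟩, h⟩, ⟨⟨d, e, f⟩, h'⟩⟩ := z
    simp at h h' ⊢
    field_simp
    linear_combination 2 * h + 2 * h'
  · obtain ⟨⟨⟨a, b, c⟩, h⟩, ⟨⟨d, e, f⟩, h'⟩⟩ := z
    simp at h h' ⊢
    field_simp
    linear_combination h - h'
  · rintro ⟨w, h, h'⟩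
    apply Subtype.ext
    funext i
    fin_cases i <;> simp <;> field_simp <;> ring
  · rintro ⟨⟨⟨a, b, c⟩, h⟩, ⟨⟨d, e, f⟩, h'⟩⟩
    simp only [Prod.mk.injEq, Subtype.mk.injEq]
    refine ⟨⟨?_, ?_, ?_⟩, ?_, ?_, ?_⟩ <;> simp <;> field_simp <;> ring
end
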